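/- For every integer k ≥ 4 and every real ε > 0 there exists N such that for every integer n ≥ N and every integer e with ⌊n²/4⌋ + 1 ≤ e ≤ n(n−1)/2, the maximal anti-Ramsey number satisfies |f(n, e, C_{2k+1}) − (e/2 + (n/2)·√(e − n²/4))| ≤ ε·n². -/

import Mathlib

open SimpleGraph

/-- The maximal anti-Ramsey number `f(n, e, C_L)`: the minimum integer `c` for which there
exists an `n`-vertex simple graph with at least `e` edges admitting an edge-coloring using at
most `c` colors in which every copy of the cycle `C_L` (i.e. every cycle of length `L`) is
rainbow. -/
noncomputable def maxAntiRamseyCycle (n e L : ℕ) : ℕ :=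
  sInf {c : ℕ | ∃ G : SimpleGraph (Fin n), e ≤ G.edgeSet.ncard ∧
    ∃ χ : Sym2 (Fin n) → ℕ, (χ '' G.edgeSet).ncard ≤ c ∧
      ∀ ⦃v : Fin n⦄ (w : G.Walk v v), w.IsCycle → w.length = L → (w.edges.map χ).Nodup}

section Walks

variable {V : Type*} {G : SimpleGraph V}

theorem exists_isPath_join {x y z w : V} {p : G.Walk x y} {q : G.Walk z w}
    (hp : p.IsPath) (hq : q.IsPath) (h : G.Adj y z) (hd : ∀ v ∈ p.support, v ∉ q.support) :
    ∃ r : G.Walk x w, r.IsPath ∧ r.length = p.length + q.length + 1 ∧ s(y, z) ∈ r.edges ∧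
      (∀ e ∈ p.edges, e ∈ r.edges) ∧ (∀ e ∈ q.edges, e ∈ r.edges) ∧
      ∀ v ∈ r.support, v ∈ p.support ∨ v ∈ q.support := by
  refine ⟨p.append (Walk.cons h q), ?_, ?_, ?_, ?_, ?_, ?_⟩
  · rw [Walk.isPath_def, Walk.support_append, Walk.support_cons, List.tail_cons]
    rw [Walk.isPath_def] at hp hq
    exact List.Nodup.append hp hq (fun v hv hv' => hd v hv hv')
  · simp [Walk.length_append]; omega
  · simp [Walk.edges_append]
  · intro e he; simp [Walk.edges_append, he]
  · intro e he; simp [Walk.edges_append, he]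
  · intro v hv
    rw [Walk.support_append, Walk.support_cons, List.tail_cons, List.mem_append] at hv
    exact hv

theorem isCycle_cons_of_isPath {u v : V} (h : G.Adj u v) {p : G.Walk v u} (hp : p.IsPath)
    (hl : 2 ≤ p.length) : (Walk.cons h p).IsCycle := by
  rw [Walk.cons_isCycle_iff]
  refine ⟨hp, fun he => ?_⟩
  cases p with
  | nil => simp at hl
  | cons h' q =>
    rw [Walk.cons_isPath_iff] at hp
    rw [Walk.edges_cons, List.mem_cons] at he
    rcases he with he | he
    · rw [Sym2.eq_swap, Sym2.congr_right] at he
      subst he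
      have h0 := (Walk.isPath_iff_nil.1 hp.1).eq_nil
      subst h0
      simp at hl
    · exact hp.2 (Walk.snd_mem_support_of_mem_edges q he)

end Walks

/-- Every cycle of length `L` in `G` is rainbow under `χ`. -/
def RainbowCycles {V : Type*} (G : SimpleGraph V) (χ : Sym2 V → ℕ) (L : ℕ) : Prop :=
  ∀ ⦃v : V⦄ (w : G.Walk v v), w.IsCycle → w.length = L → (w.edges.map χ).Nodup

theorem RainbowCycles.ne_of_isPath {V : Type*} {G : SimpleGraph V} {χ : Sym2 V → ℕ} {L : ℕ}
    (hχ : RainbowCycles G χ (L + 1)) (hL : 2 ≤ L) {u v : V} (h : G.Adj u v) {p : G.Walk v u}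
    (hp : p.IsPath) (hl : p.length = L) {e e' : Sym2 V} (he : e = s(u, v) ∨ e ∈ p.edges)
    (he' : e' = s(u, v) ∨ e' ∈ p.edges) (hne : e ≠ e') : χ e ≠ χ e' := by
  intro heq
  have h1 := hχ (Walk.cons h p) (isCycle_cons_of_isPath h hp (hl ▸ hL)) (by simp [hl])
  refine hne (List.inj_on_of_nodup_map h1 ?_ ?_ heq) <;> simpa [Walk.edges_cons]

open scoped Classical in
/-- `RobustWalk G c i x y`: there are robustly many walks from `x` to `y` with `i` interior
vertices, in the sense that the interior vertices can be chosen one after the other with at least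
`c * |V|` choices each (the last one depending on `y`). -/
def RobustWalk {V : Type*} [Fintype V] (G : SimpleGraph V) (c : ℝ) : ℕ → V → V → Prop
  | 0, x, y => G.Adj x y
  | i + 1, x, y =>
    c * Fintype.card V ≤ ((Finset.univ.filter fun z => G.Adj x z ∧ RobustWalk G c i z y).card : ℝ)

theorem RobustWalk.exists_isPath {V : Type*} [Fintype V] {G : SimpleGraph V} {c : ℝ} {i : ℕ}
    {x y : V} (h : RobustWalk G c i x y) (X : Finset V) (hxy : x ≠ y) (hx : x ∉ X) (hy : y ∉ X)
    (hX : (X.card + i + 2 : ℝ) < c * Fintype.card V) :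
    ∃ p : G.Walk x y, p.IsPath ∧ p.length = i + 1 ∧ ∀ w ∈ p.support, w ∉ X := by
  classical
  induction i generalizing x X with
  | zero =>
    have h' : G.Adj x y := h
    refine ⟨Walk.cons h' Walk.nil, ?_, by simp, ?_⟩
    · simp [Walk.cons_isPath_iff, hxy]
    · intro w hw
      simp at hw
      rcases hw with rfl | rfl <;> assumption
  | succ i ih =>
    rw [RobustWalk] at h
    obtain ⟨z, hz, hzX⟩ : ∃ z ∈ (Finset.univ.filter fun z => G.Adj x z ∧ RobustWalk G c i z y),
        z ∉ insert x (insert y X) := by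
      apply Finset.exists_mem_notMem_of_card_lt_card
      have h1 : (insert x (insert y X)).card ≤ X.card + 2 :=
        (Finset.card_insert_le _ _).trans (by have := Finset.card_insert_le y X; omega)
      have h2 : ((insert x (insert y X)).card : ℝ) ≤ X.card + 2 := by exact_mod_cast h1
      push_cast at hX
      have h3 : (0 : ℝ) ≤ i := by positivity
      have h4 : ((insert x (insert y X)).card : ℝ) < (Finset.univ.filter fun z => G.Adj x z ∧ RobustWalk G c i z y).card := by
        refine lt_of_lt_of_le ?_ h
        linarith
      exact_mod_cast h4
    simp only [Finset.mem_insert, not_or] at hzX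
    simp only [Finset.mem_filter, Finset.mem_univ, true_and] at hz
    obtain ⟨p, hp, hl, hs⟩ := ih hz.2 (insert x X) hzX.2.1
      (by simp [hzX.1, hzX.2.2]) (by simp [hy, Ne.symm hxy]) (by
        have h1 : ((insert x X).card : ℝ) ≤ X.card + 1 := by
          exact_mod_cast Finset.card_insert_le x X
        push_cast at hX
        linarith)
    refine ⟨Walk.cons hz.1 p, ?_, by simp [hl], ?_⟩
    · rw [Walk.cons_isPath_iff]
      exact ⟨hp, fun hx' => hs x hx' (by simp)⟩
    · intro w hw
      rw [Walk.support_cons, List.mem_cons] at hw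
      rcases hw with rfl | hw
      · exact hx
      · exact fun h => hs w hw (by simp [h])

theorem robustWalk_succ_iff {V : Type*} [Fintype V] {G : SimpleGraph V} {c : ℝ} {i : ℕ}
    {x y : V} : RobustWalk G c (i + 1) x y ↔
      ∃ S : Finset V, (∀ z ∈ S, G.Adj x z ∧ RobustWalk G c i z y) ∧
        c * Fintype.card V ≤ (S.card : ℝ) := by
  classical
  constructor
  · intro h
    exact ⟨_, fun z hz => (Finset.mem_filter.1 hz).2, h⟩
  · rintro ⟨S, hS, hc⟩
    refine hc.trans ?_
    gcongr
    intro z hz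
    exact Finset.mem_filter.2 ⟨Finset.mem_univ _, hS z hz⟩

section Conflict

variable {V : Type*} {G : SimpleGraph V} {χ : Sym2 V → ℕ} {L : ℕ}

theorem RainbowCycles.ne_of_disjoint_edges (hχ : RainbowCycles G χ (L + 1)) (hL : 2 ≤ L)
    {x₁ y₁ x₂ y₂ : V} (h₁ : G.Adj x₁ y₁) (h₂ : G.Adj x₂ y₂) (hne : x₁ ≠ x₂)
    {p : G.Walk x₁ x₂} {q : G.Walk y₁ y₂} (hp : p.IsPath) (hq : q.IsPath)
    (hd : ∀ v ∈ p.support, v ∉ q.support) (hl : p.length + q.length + 1 = L) :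
    χ s(x₁, y₁) ≠ χ s(x₂, y₂) := by
  obtain ⟨r, hr, hrl, hre, -, -, -⟩ := exists_isPath_join hq hp.reverse h₂.symm
    (fun v hv hv' => hd v (by simpa using hv') hv)
  refine hχ.ne_of_isPath hL h₁ hr ?_ (Or.inl rfl) (Or.inr (Sym2.eq_swap ▸ hre)) ?_
  · rw [hrl, Walk.length_reverse]; omega
  · intro h
    rcases Sym2.eq_iff.1 h with h | h
    · exact hne h.1
    · exact hd x₁ p.start_mem_support (h.1 ▸ q.end_mem_support)

theorem RainbowCycles.ne_of_common_vertex (hχ : RainbowCycles G χ (L + 1)) (hL : 2 ≤ L)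
    {a b u : V} (ha : G.Adj a u) (hb : G.Adj b u) (hne : a ≠ b)
    {p : G.Walk a b} (hp : p.IsPath) (hu : u ∉ p.support) (hl : p.length + 1 = L) :
    χ s(a, u) ≠ χ s(b, u) := by
  have hq : (Walk.cons hb.symm p.reverse).IsPath := by
    rw [Walk.cons_isPath_iff]
    exact ⟨hp.reverse, by simpa using hu⟩
  refine hχ.ne_of_isPath hL ha hq ?_ (Or.inl rfl) (Or.inr ?_) ?_
  · simp [hl]
  · simp [Sym2.eq_swap]
  · intro h
    rw [Sym2.congr_left] at h
    exact hne h

theorem card_le_ncard_colors [Finite V] (E : Finset (Sym2 V)) (hE : ∀ e ∈ E, e ∈ G.edgeSet)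
    (hne : ∀ e ∈ E, ∀ e' ∈ E, e ≠ e' → χ e ≠ χ e') :
    E.card ≤ (χ '' G.edgeSet).ncard := by
  classical
  have h1 : (E.image χ).card = E.card := by
    apply Finset.card_image_of_injOn
    intro a ha b hb hab
    by_contra h
    exact hne a ha b hb h hab
  rw [← h1, ← Set.ncard_coe_finset]
  apply Set.ncard_le_ncard _ (Set.toFinite _)
  intro z hz
  simp only [Finset.coe_image, Set.mem_image, Finset.mem_coe] at hz ⊢
  obtain ⟨e, he, rfl⟩ := hz
  exact ⟨e, hE e he, rfl⟩

theorem card_le_two_mul_ncard_colors [Finite V] (O : Finset (V × V))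
    (hO : ∀ p ∈ O, G.Adj p.1 p.2)
    (hne : ∀ p ∈ O, ∀ q ∈ O, s(p.1, p.2) ≠ s(q.1, q.2) → χ s(p.1, p.2) ≠ χ s(q.1, q.2)) :
    O.card ≤ 2 * (χ '' G.edgeSet).ncard := by
  classical
  have h1 : O.card ≤ 2 * (O.image fun p => s(p.1, p.2)).card := by
    apply Finset.card_le_mul_card_image
    intro e he
    obtain ⟨p, hp, rfl⟩ := Finset.mem_image.1 he
    have : O.filter (fun q => s(q.1, q.2) = s(p.1, p.2)) ⊆ {p, (p.2, p.1)} := by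
      intro q hq
      rw [Finset.mem_filter, Sym2.eq_iff] at hq
      rw [Finset.mem_insert, Finset.mem_singleton, Prod.ext_iff, Prod.ext_iff]
      exact hq.2
    exact (Finset.card_le_card this).trans Finset.card_le_two
  refine h1.trans (Nat.mul_le_mul_left 2 (card_le_ncard_colors _ ?_ ?_))
  · intro e he
    obtain ⟨p, hp, rfl⟩ := Finset.mem_image.1 he
    exact hO p hp
  · intro e he e' he'
    obtain ⟨p, hp, rfl⟩ := Finset.mem_image.1 he
    obtain ⟨q, hq, rfl⟩ := Finset.mem_image.1 he'
    exact hne p hp q hq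

end Conflict

section Neighbours

open scoped Classical in
/-- The number of neighbours of `x` in `S`, as a real number. -/
noncomputable def nbr {V : Type*} (G : SimpleGraph V) (x : V) (S : Finset V) : ℝ :=
  ((S.filter fun y => G.Adj x y).card : ℝ)

variable {V : Type*} {G : SimpleGraph V}

theorem nbr_nonneg (x : V) (S : Finset V) : 0 ≤ nbr G x S := Nat.cast_nonneg _

theorem nbr_eq_card (x : V) (S : Finset V) [DecidablePred fun y => G.Adj x y] :
    nbr G x S = ((S.filter fun y => G.Adj x y).card : ℝ) := by
  unfold nbr; congr

theorem exists_nbr_eq_card (x : V) (S : Finset V) :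
    ∃ T ⊆ S, (∀ y, y ∈ T ↔ y ∈ S ∧ G.Adj x y) ∧ nbr G x S = (T.card : ℝ) := by
  classical
  exact ⟨_, Finset.filter_subset _ _, fun y => Finset.mem_filter, nbr_eq_card x S⟩

theorem card_le_nbr {x : V} {S T : Finset V} (hT : T ⊆ S) (h : ∀ y ∈ T, G.Adj x y) :
    (T.card : ℝ) ≤ nbr G x S := by
  classical
  rw [nbr_eq_card]
  gcongr
  intro y hy
  exact Finset.mem_filter.2 ⟨hT hy, h y hy⟩

theorem nbr_le_card (x : V) (S : Finset V) : nbr G x S ≤ S.card := by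
  obtain ⟨T, hT, -, h⟩ := exists_nbr_eq_card (G := G) x S
  rw [h]
  gcongr

theorem nbr_mono (x : V) {S T : Finset V} (h : S ⊆ T) : nbr G x S ≤ nbr G x T := by
  obtain ⟨T', hT', h1, h2⟩ := exists_nbr_eq_card (G := G) x S
  rw [h2]
  exact card_le_nbr (hT'.trans h) fun y hy => ((h1 y).1 hy).2

theorem nbr_union_le [DecidableEq V] (x : V) (S T : Finset V) :
    nbr G x (S ∪ T) ≤ nbr G x S + nbr G x T := by
  classical
  unfold nbr
  rw [Finset.filter_union]
  exact_mod_cast Finset.card_union_le _ _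

theorem nbr_union [DecidableEq V] (x : V) {S T : Finset V} (h : Disjoint S T) :
    nbr G x (S ∪ T) = nbr G x S + nbr G x T := by
  classical
  unfold nbr
  rw [Finset.filter_union, Finset.card_union_of_disjoint (Finset.disjoint_filter_filter h)]
  push_cast; rfl

theorem sum_nbr_comm (S T : Finset V) : ∑ x ∈ S, nbr G x T = ∑ y ∈ T, nbr G y S := by
  classical
  unfold nbr
  rw [← Nat.cast_sum, ← Nat.cast_sum]
  congr 1
  have := Finset.sum_card_bipartiteAbove_eq_sum_card_bipartiteBelow (s := S) (t := T)
    (fun x y => G.Adj x y)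
  simp only [Finset.bipartiteAbove, Finset.bipartiteBelow] at this
  convert this using 4
  rw [G.adj_comm]

end Neighbours

section Linked

variable {V : Type*} [Fintype V] {G : SimpleGraph V} {c : ℝ}

theorem RobustWalk.succ_of_forall {Q : Finset V} (hQ : ∀ x ∈ Q, c * Fintype.card V + 1 ≤ nbr G x Q)
    {i : ℕ} (h : ∀ x ∈ Q, ∀ y ∈ Q, x ≠ y → RobustWalk G c i x y) :
    ∀ x ∈ Q, ∀ y ∈ Q, x ≠ y → RobustWalk G c (i + 1) x y := by
  classical
  intro x hx y hy _
  obtain ⟨T, hT, h1, h2⟩ := exists_nbr_eq_card (G := G) x Q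
  refine robustWalk_succ_iff.2 ⟨T.erase y, fun z hz => ?_, ?_⟩
  · rw [Finset.mem_erase] at hz
    exact ⟨((h1 z).1 hz.2).2, h z (hT hz.2) y hy hz.1⟩
  · have h3 := hQ x hx
    have h4 : (T.card : ℝ) ≤ (T.erase y).card + 1 := by
      have h5 : T.card ≤ (T.erase y).card + 1 := by
        have := Finset.pred_card_le_card_erase (s := T) (a := y)
        omega
      exact_mod_cast h5
    linarith

theorem RobustWalk.of_le_of_forall {Q : Finset V}
    (hQ : ∀ x ∈ Q, c * Fintype.card V + 1 ≤ nbr G x Q) {i j : ℕ} (hij : i ≤ j)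
    (h : ∀ x ∈ Q, ∀ y ∈ Q, x ≠ y → RobustWalk G c i x y) :
    ∀ x ∈ Q, ∀ y ∈ Q, x ≠ y → RobustWalk G c j x y := by
  induction j, hij using Nat.le_induction with
  | base => exact h
  | succ j _ ih => exact RobustWalk.succ_of_forall hQ ih

end Linked

section MainConflict

variable {V : Type*} [Fintype V] {G : SimpleGraph V} {c : ℝ} {χ : Sym2 V → ℕ} {k : ℕ}

/-- `x` and `y` are robustly joined by paths with one or with two interior vertices. -/
def ShortLinked (G : SimpleGraph V) (c : ℝ) (x y : V) : Prop :=
  RobustWalk G c 1 x y ∨ RobustWalk G c 2 x y ∨ RobustWalk G c 2 y x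

theorem ShortLinked.exists_isPath {x y : V} (h : ShortLinked G c x y) (X : Finset V)
    (hxy : x ≠ y) (hx : x ∉ X) (hy : y ∉ X) (hX : (X.card + 4 : ℝ) < c * Fintype.card V) :
    ∃ p : G.Walk x y, p.IsPath ∧ (p.length = 2 ∨ p.length = 3) ∧ ∀ w ∈ p.support, w ∉ X := by
  rcases h with h | h | h
  · obtain ⟨p, h1, h2, h3⟩ := h.exists_isPath X hxy hx hy (by push_cast; linarith)
    exact ⟨p, h1, Or.inl h2, h3⟩
  · obtain ⟨p, h1, h2, h3⟩ := h.exists_isPath X hxy hx hy (by push_cast; linarith)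
    exact ⟨p, h1, Or.inr h2, h3⟩
  · obtain ⟨p, h1, h2, h3⟩ := h.exists_isPath X hxy.symm hy hx (by push_cast; linarith)
    exact ⟨p.reverse, h1.reverse, Or.inr (by simpa using h2), fun w hw => h3 w (by simpa using hw)⟩

theorem RainbowCycles.ne_of_shortLinked (hχ : RainbowCycles G χ (2 * k + 1)) (hk : 4 ≤ k)
    (hn : (4 * k + 10 : ℝ) < c * Fintype.card V) {Q : Finset V}
    (hQ : ∀ x ∈ Q, ∀ y ∈ Q, x ≠ y → RobustWalk G c 3 x y)
    (hd : ∀ x ∈ Q, c * Fintype.card V + 1 ≤ nbr G x Q) {k₁ u₁ k₂ u₂ : V}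
    (hk₁ : k₁ ∈ Q) (hk₂ : k₂ ∈ Q) (hu₁ : u₁ ∈ Q) (hu₂ : u₂ ∈ Q)
    (hl : k₁ ≠ k₂ → ShortLinked G c k₁ k₂) (h₁ : G.Adj k₁ u₁) (h₂ : G.Adj k₂ u₂)
    (hne : s(k₁, u₁) ≠ s(k₂, u₂)) : χ s(k₁, u₁) ≠ χ s(k₂, u₂) := by
  classical
  have hk' : (4 : ℝ) ≤ k := by exact_mod_cast hk
  have hR : ∀ i, 3 ≤ i → ∀ x ∈ Q, ∀ y ∈ Q, x ≠ y → RobustWalk G c i x y :=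
    fun i hi => RobustWalk.of_le_of_forall hd hi hQ
  have common : ∀ a ∈ Q, ∀ b ∈ Q, ∀ u, G.Adj a u → G.Adj b u → a ≠ b →
      χ s(a, u) ≠ χ s(b, u) := by
    intro a ha b hb u hau hbu hab
    obtain ⟨p, hp, hpl, hpu⟩ := (hR (2 * k - 2) (by omega) a ha b hb hab).exists_isPath {u} hab
      (by simpa using hau.ne) (by simpa using hbu.ne) (by
        rw [Finset.card_singleton]
        have : ((2 * k - 2 : ℕ) : ℝ) ≤ 2 * k := by exact_mod_cast Nat.sub_le _ _
        push_cast; linarith)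
    exact hχ.ne_of_common_vertex (by omega) hau hbu hab hp
      (fun h => hpu u h (Finset.mem_singleton_self u)) (by omega)
  by_cases hkk : k₁ = k₂
  · subst hkk
    have := common u₁ hu₁ u₂ hu₂ k₁ h₁.symm h₂.symm (fun h => hne (by rw [h]))
    rwa [Sym2.eq_swap, Sym2.eq_swap (a := k₁)]
  by_cases huu : u₁ = u₂
  · subst huu
    exact common k₁ hk₁ k₂ hk₂ u₁ h₁ h₂ hkk
  by_cases hku : k₁ = u₂
  · subst hku
    have := common u₁ hu₁ k₂ hk₂ k₁ h₁.symm h₂ (fun h => hne (by rw [h, Sym2.eq_swap]))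
    rwa [Sym2.eq_swap]
  by_cases huk : u₁ = k₂
  · subst huk
    have := common k₁ hk₁ u₂ hu₂ u₁ h₁ h₂.symm hku
    rwa [Sym2.eq_swap (a := u₁)]
  obtain ⟨p, hp, hpl, hpX⟩ := (hl hkk).exists_isPath {u₁, u₂} hkk
    (by simp [h₁.ne, hku]) (by simp [h₂.ne, Ne.symm huk]) (by
      have : ((({u₁, u₂} : Finset V).card : ℕ) : ℝ) ≤ 2 := by exact_mod_cast Finset.card_le_two
      linarith)
  have hps : p.support.toFinset.card ≤ 4 := by
    refine (List.toFinset_card_le _).trans ?_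
    rw [Walk.length_support]; omega
  have hu₁p : u₁ ∉ p.support := fun h => hpX _ h (by simp)
  have hu₂p : u₂ ∉ p.support := fun h => hpX _ h (by simp)
  obtain ⟨q, hq, hql, hqX⟩ := (hR (2 * k - 2 - p.length) (by omega) u₁ hu₁ u₂ hu₂ huu).exists_isPath
    p.support.toFinset huu (by simpa using hu₁p) (by simpa using hu₂p) (by
      have h1 : ((2 * k - 2 - p.length : ℕ) : ℝ) ≤ 2 * k := by
        have : 2 * k - 2 - p.length ≤ 2 * k := by omega
        exact_mod_cast this
      have h2 : (p.support.toFinset.card : ℝ) ≤ 4 := by exact_mod_cast hps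
      linarith)
  refine hχ.ne_of_disjoint_edges (by omega) h₁ h₂ hkk hp hq (fun v hv hv' => hqX v hv' ?_)
    (by omega)
  simpa using hv

theorem sum_nbr_le_ncard_colors (hχ : RainbowCycles G χ (2 * k + 1)) (hk : 4 ≤ k)
    (hn : (4 * k + 10 : ℝ) < c * Fintype.card V) {Q C : Finset V}
    (hQ : ∀ x ∈ Q, ∀ y ∈ Q, x ≠ y → RobustWalk G c 3 x y)
    (hd : ∀ x ∈ Q, c * Fintype.card V + 1 ≤ nbr G x Q)
    (hC : ∀ x ∈ Q, x ∉ C → ∀ y ∈ Q, y ∉ C → x ≠ y → ShortLinked G c x y) :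
    ∑ x ∈ Q, nbr G x Q ≤ 2 * ((χ '' G.edgeSet).ncard : ℝ) + (C.card : ℝ) ^ 2 := by
  classical
  set O : Finset (V × V) := (Q ×ˢ Q).filter fun p => G.Adj p.1 p.2 ∧ ¬ (p.1 ∈ C ∧ p.2 ∈ C)
    with hO
  have key : ∀ p ∈ O, ∃ a b, a ∈ Q ∧ a ∉ C ∧ b ∈ Q ∧ G.Adj a b ∧ s(p.1, p.2) = s(a, b) := by
    rintro ⟨x, y⟩ hp
    simp only [hO, Finset.mem_filter, Finset.mem_product] at hp
    by_cases hx : x ∈ C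
    · exact ⟨y, x, hp.1.2, fun h => hp.2.2 ⟨hx, h⟩, hp.1.1, hp.2.1.symm, Sym2.eq_swap⟩
    · exact ⟨x, y, hp.1.1, hx, hp.1.2, hp.2.1, rfl⟩
  have h1 : O.card ≤ 2 * (χ '' G.edgeSet).ncard := by
    apply card_le_two_mul_ncard_colors
    · intro p hp
      exact (Finset.mem_filter.1 hp).2.1
    · intro p hp q hq hne
      obtain ⟨a, b, ha, haC, hb, hab, h⟩ := key p hp
      obtain ⟨a', b', ha', haC', hb', hab', h'⟩ := key q hq
      rw [h, h'] at hne ⊢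
      exact hχ.ne_of_shortLinked hk hn hQ hd ha ha' hb hb' (hC a ha haC a' ha' haC') hab hab' hne
  have h2 : ((Q ×ˢ Q).filter fun p => G.Adj p.1 p.2) ⊆ O ∪ C ×ˢ C := by
    intro p hp
    rw [Finset.mem_filter] at hp
    rw [Finset.mem_union, hO, Finset.mem_filter, Finset.mem_product (s := C)]
    tauto
  have h3 : ((Q ×ˢ Q).filter fun p => G.Adj p.1 p.2).card ≤ O.card + C.card * C.card := by
    refine (Finset.card_le_card h2).trans ((Finset.card_union_le _ _).trans ?_)
    rw [Finset.card_product]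
  have h4 : ∑ x ∈ Q, nbr G x Q = (((Q ×ˢ Q).filter fun p => G.Adj p.1 p.2).card : ℝ) := by
    simp_rw [nbr_eq_card]
    rw [← Nat.cast_sum, ← Finset.card_sigma]
    congr 1
    refine Finset.card_bij (fun p _ => (p.1, p.2)) ?_ ?_ ?_
    · rintro ⟨x, y⟩ h
      simpa [and_assoc] using h
    · rintro ⟨x, y⟩ _ ⟨x', y'⟩ _ h
      simpa using h
    · rintro ⟨x, y⟩ h
      exact ⟨⟨x, y⟩, by simpa [and_assoc] using h, rfl⟩
  rw [h4]
  have h5 : (((Q ×ˢ Q).filter fun p => G.Adj p.1 p.2).card : ℝ) ≤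
      ((2 * (χ '' G.edgeSet).ncard + C.card * C.card : ℕ) : ℝ) := by
    exact_mod_cast h3.trans (Nat.add_le_add_right h1 _)
  refine h5.trans (le_of_eq ?_)
  push_cast; ring

end MainConflict

section Misses

variable {V : Type*} {G : SimpleGraph V}

/-- The number of vertices of `S` that are not adjacent to `x`, as a real number. -/
noncomputable def mis (G : SimpleGraph V) (x : V) (S : Finset V) : ℝ := S.card - nbr G x S

theorem mis_eq_card [DecidableEq V] (x : V) (S : Finset V) [DecidablePred fun y => G.Adj x y] :
    mis G x S = ((S.filter fun y => ¬ G.Adj x y).card : ℝ) := by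
  have := Finset.card_filter_add_card_filter_not (s := S) (fun y => G.Adj x y)
  rw [mis, nbr_eq_card, ← this]
  push_cast; ring

theorem mis_nonneg (x : V) (S : Finset V) : 0 ≤ mis G x S :=
  sub_nonneg.2 (nbr_le_card x S)

theorem mis_le_card (x : V) (S : Finset V) : mis G x S ≤ S.card := by
  have := nbr_nonneg (G := G) x S
  unfold mis; linarith

theorem mis_mono (x : V) {S T : Finset V} (h : S ⊆ T) : mis G x S ≤ mis G x T := by
  classical
  rw [mis_eq_card, mis_eq_card]
  gcongr

theorem nbr_eq_card_sub_mis (x : V) (S : Finset V) : nbr G x S = S.card - mis G x S := by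
  simp [mis]

theorem sum_mis_comm (S T : Finset V) : ∑ x ∈ S, mis G x T = ∑ y ∈ T, mis G y S := by
  simp only [mis, Finset.sum_sub_distrib, sum_nbr_comm (G := G) S T, Finset.sum_const,
    nsmul_eq_mul]
  ring

theorem mul_card_filter_lt_le_sum {S : Finset V} {f : V → ℝ} (hf : ∀ x ∈ S, 0 ≤ f x) (a : ℝ)
    [DecidablePred fun x => a < f x] :
    a * ((S.filter fun x => a < f x).card : ℝ) ≤ ∑ x ∈ S, f x := by
  calc a * ((S.filter fun x => a < f x).card : ℝ)
      = ∑ _x ∈ S.filter (fun x => a < f x), a := by simp [mul_comm]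
    _ ≤ ∑ x ∈ S.filter (fun x => a < f x), f x :=
        Finset.sum_le_sum fun x hx => (Finset.mem_filter.1 hx).2.le
    _ ≤ ∑ x ∈ S, f x :=
        Finset.sum_le_sum_of_subset_of_nonneg (Finset.filter_subset _ _) fun x hx _ => hf x hx

variable [Fintype V] {c : ℝ}

theorem mis_univ_ge (w : V) (S : Finset V) :
    (S.card : ℝ) - nbr G w S ≤ mis G w Finset.univ :=
  mis_mono w (Finset.subset_univ S)

theorem robustWalk_succ_of_le_nbr {i : ℕ} {x y : V} (T : Finset V)
    (hT : ∀ z ∈ T, z ≠ y → RobustWalk G c i z y) (h : c * Fintype.card V + 1 ≤ nbr G x T) :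
    RobustWalk G c (i + 1) x y := by
  classical
  obtain ⟨S, hS, h1, h2⟩ := exists_nbr_eq_card (G := G) x T
  refine robustWalk_succ_iff.2 ⟨S.erase y, fun z hz => ?_, ?_⟩
  · rw [Finset.mem_erase] at hz
    exact ⟨((h1 z).1 hz.2).2, hT z (hS hz.2) hz.1⟩
  · have h4 : (S.card : ℝ) ≤ (S.erase y).card + 1 := by
      have h5 : S.card ≤ (S.erase y).card + 1 := by
        have := Finset.pred_card_le_card_erase (s := S) (a := y)
        omega
      exact_mod_cast h5
    linarith

theorem robustWalk_one_of_le {x y : V} (S : Finset V)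
    (h : c * Fintype.card V ≤ nbr G x S - mis G y S) : RobustWalk G c 1 x y := by
  classical
  refine robustWalk_succ_iff.2 ⟨(S.filter fun z => G.Adj x z) \ (S.filter fun z => ¬ G.Adj y z),
    fun z hz => ?_, ?_⟩
  · simp only [Finset.mem_sdiff, Finset.mem_filter] at hz
    exact ⟨hz.1.2, (by_contra fun h' => hz.2 ⟨hz.1.1, fun h'' => h' h''.symm⟩ : G.Adj z y)⟩
  · rw [nbr_eq_card, mis_eq_card] at h
    have h1 : (S.filter fun z => G.Adj x z).card ≤
        ((S.filter fun z => G.Adj x z) \ (S.filter fun z => ¬ G.Adj y z)).card +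
        (S.filter fun z => ¬ G.Adj y z).card := by
      have := Finset.le_card_sdiff (S.filter fun z => ¬ G.Adj y z) (S.filter fun z => G.Adj x z)
      omega
    have h2 : ((S.filter fun z => G.Adj x z).card : ℝ) ≤
        ((S.filter fun z => G.Adj x z) \ (S.filter fun z => ¬ G.Adj y z)).card +
        (S.filter fun z => ¬ G.Adj y z).card := by exact_mod_cast h1
    linarith

end Misses

section NearClique

variable {V : Type*} [Fintype V] {G : SimpleGraph V} {χ : Sym2 V → ℕ} {k : ℕ}

theorem sq_card_le_of_near_clique (hχ : RainbowCycles G χ (2 * k + 1)) (hk : 4 ≤ k)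
    (hn : (4 * k + 10 : ℝ) < 1 / 10 * Fintype.card V) {P : Finset V} {δ : ℝ} (hδ : 0 < δ)
    (hδ' : δ ≤ 1 / 30) (hP : (Fintype.card V : ℝ) / 3 ≤ P.card)
    (hm : ∑ w ∈ P, mis G w P ≤ δ ^ 2 * (Fintype.card V : ℝ) ^ 2) :
    (P.card : ℝ) ^ 2 - 3 * δ * (Fintype.card V : ℝ) ^ 2 ≤ 2 * ((χ '' G.edgeSet).ncard : ℝ) := by
  classical
  set n : ℝ := (Fintype.card V : ℝ) with hn'
  have hk0 : (0 : ℝ) ≤ k := by positivity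
  have hn0 : 0 < n := by linarith
  have hn100 : 100 ≤ n := by linarith
  set Q := P.filter fun w => ¬ δ * n < mis G w P with hQ
  have hQP : Q ⊆ P := Finset.filter_subset _ _
  have hcard : ((P.filter fun w => δ * n < mis G w P).card : ℝ) + Q.card = P.card := by
    exact_mod_cast Finset.card_filter_add_card_filter_not (s := P) (fun w => δ * n < mis G w P)
  have hmark := mul_card_filter_lt_le_sum (S := P) (fun w _ => mis_nonneg (G := G) w P) (δ * n)
  have hbad : ((P.filter fun w => δ * n < mis G w P).card : ℝ) ≤ δ * n := by
    have h1 : 0 < δ * n := by positivity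
    refine le_of_mul_le_mul_left ?_ h1
    nlinarith
  have hQm : ∀ x ∈ Q, mis G x Q ≤ δ * n := fun x hx =>
    (mis_mono x hQP).trans (not_lt.1 (Finset.mem_filter.1 hx).2)
  have hPn : (P.card : ℝ) ≤ n := by
    rw [hn']; exact_mod_cast Finset.card_le_univ P
  have hδn : δ * n ≤ n / 30 := by nlinarith
  have hd : ∀ x ∈ Q, 1 / 10 * n + 1 ≤ nbr G x Q := by
    intro x hx
    have := hQm x hx
    rw [nbr_eq_card_sub_mis]
    linarith
  have h1 : ∀ x ∈ Q, ∀ y ∈ Q, x ≠ y → RobustWalk G (1 / 10) 1 x y := by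
    intro x hx y hy _
    apply robustWalk_one_of_le Q
    have := hQm x hx
    have := hQm y hy
    rw [nbr_eq_card_sub_mis]
    linarith
  have h3 := RobustWalk.of_le_of_forall hd (show 1 ≤ 3 by norm_num) h1
  have h4 := sum_nbr_le_ncard_colors (C := ∅) hχ hk hn h3 hd
    (fun x hx _ y hy _ hxy => Or.inl (h1 x hx y hy hxy))
  have h5 : ∑ _x ∈ Q, ((Q.card : ℝ) - δ * n) ≤ ∑ x ∈ Q, nbr G x Q :=
    Finset.sum_le_sum fun x hx => by
      have := hQm x hx
      rw [nbr_eq_card_sub_mis]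
      linarith
  rw [Finset.sum_const, nsmul_eq_mul] at h5
  simp only [Finset.card_empty, Nat.cast_zero, ne_eq, OfNat.ofNat_ne_zero, not_false_eq_true,
    zero_pow, add_zero] at h4
  have hq : (P.card : ℝ) - δ * n ≤ Q.card := by linarith
  have hq' : (Q.card : ℝ) ≤ n := by linarith [Nat.cast_nonneg (α := ℝ) (P.filter fun w => δ * n < mis G w P).card]
  have hδn0 : 0 < δ * n := by positivity
  have hp0 : 0 ≤ (P.card : ℝ) - δ * n := by linarith
  nlinarith [mul_le_mul hq hq hp0 (by positivity)]

end NearClique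

section NearBipartite

variable {V : Type*} [Fintype V] {G : SimpleGraph V} {c : ℝ} {χ : Sym2 V → ℕ} {k : ℕ}

theorem RainbowCycles.ne_of_through_edge (hχ : RainbowCycles G χ (2 * k + 1)) (hk : 4 ≤ k)
    (hn : (4 * k + 10 : ℝ) < c * Fintype.card V) {u v x₁ y₁ x₂ y₂ : V} {i₁ i₃ l : ℕ}
    (huv : G.Adj u v) (h₁ : G.Adj x₁ y₁) (h₂ : G.Adj x₂ y₂) (hxx : x₁ ≠ x₂)
    (hxy : x₁ ≠ y₂) (hyx : x₂ ≠ y₁) (hu : u ≠ x₁ ∧ u ≠ x₂ ∧ u ≠ y₁ ∧ u ≠ y₂)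
    (hv : v ≠ x₁ ∧ v ≠ x₂ ∧ v ≠ y₁ ∧ v ≠ y₂) (hi : i₁ + l + i₃ + 4 = 2 * k)
    (hux : RobustWalk G c i₁ u x₁) (hvx : RobustWalk G c i₃ v x₂)
    (hyy : ∀ X : Finset V, y₁ ∉ X → y₂ ∉ X → X.card + l ≤ 4 * k →
      ∃ p : G.Walk y₁ y₂, p.IsPath ∧ p.length = l ∧ ∀ w ∈ p.support, w ∉ X) :
    χ s(x₁, y₁) ≠ χ s(x₂, y₂) := by
  classical
  have c4 : ∀ a b c d : V, ({a, b, c, d} : Finset V).card ≤ 4 := fun a b c d => Finset.card_le_four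
  obtain ⟨p₁, hp₁, hl₁, ha₁⟩ := hux.exists_isPath {v, x₂, y₁, y₂} hu.1
    (by simp [huv.ne, hu]) (by simp [hxx, hxy, h₁.ne, Ne.symm hv.1]) (by
      have h1 : (({v, x₂, y₁, y₂} : Finset V).card : ℝ) ≤ 4 := by exact_mod_cast c4 _ _ _ _
      have h2 : (i₁ : ℝ) ≤ 2 * k := by exact_mod_cast (show i₁ ≤ 2 * k by omega)
      have h3 : (0 : ℝ) ≤ k := by positivity
      linarith)
  have hs₁ : p₁.support.toFinset.card ≤ i₁ + 2 := by
    refine (List.toFinset_card_le _).trans ?_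
    rw [Walk.length_support]; omega
  have n₁ : ∀ w ∈ p₁.support, w ≠ v ∧ w ≠ x₂ ∧ w ≠ y₁ ∧ w ≠ y₂ := by
    intro w hw
    have := ha₁ w hw
    simp only [Finset.mem_insert, Finset.mem_singleton, not_or] at this
    exact this
  obtain ⟨p₂, hp₂, hl₂, ha₂⟩ := hyy (insert v (insert x₂ p₁.support.toFinset))
    (by
      simp only [Finset.mem_insert, List.mem_toFinset, not_or]
      exact ⟨Ne.symm hv.2.2.1, Ne.symm hyx, fun h => (n₁ _ h).2.2.1 rfl⟩)
    (by
      simp only [Finset.mem_insert, List.mem_toFinset, not_or]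
      exact ⟨Ne.symm hv.2.2.2, h₂.ne.symm, fun h => (n₁ _ h).2.2.2 rfl⟩)
    (by
      have h1 := Finset.card_insert_le v (insert x₂ p₁.support.toFinset)
      have h2 := Finset.card_insert_le x₂ p₁.support.toFinset
      omega)
  have n₂ : ∀ w ∈ p₂.support, w ≠ v ∧ w ≠ x₂ ∧ w ∉ p₁.support := by
    intro w hw
    have := ha₂ w hw
    simp only [Finset.mem_insert, List.mem_toFinset, not_or] at this
    exact this
  obtain ⟨r, hr, hrl, hre, -, -, hrs⟩ := exists_isPath_join hp₁ hp₂ h₁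
    (fun w hw hw' => (n₂ w hw').2.2 hw)
  have hsr : r.support.toFinset.card ≤ 2 * k := by
    refine (List.toFinset_card_le _).trans ?_
    rw [Walk.length_support]; omega
  obtain ⟨p₃, hp₃, hl₃, ha₃⟩ := hvx.exists_isPath r.support.toFinset hv.2.1
    (by
      intro h
      rcases hrs v (by simpa using h) with h | h
      · exact (n₁ v h).1 rfl
      · exact (n₂ v h).1 rfl)
    (by
      intro h
      rcases hrs x₂ (by simpa using h) with h | h
      · exact (n₁ _ h).2.1 rfl
      · exact (n₂ _ h).2.1 rfl)
    (by
      have h1 : (r.support.toFinset.card : ℝ) ≤ 2 * k := by exact_mod_cast hsr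
      have h2 : (i₃ : ℝ) ≤ 2 * k := by exact_mod_cast (show i₃ ≤ 2 * k by omega)
      linarith)
  obtain ⟨t, ht, htl, hte, hte', -, -⟩ := exists_isPath_join hr hp₃.reverse h₂.symm
    (fun w hw hw' => ha₃ w (by simpa using hw') (by simpa using hw))
  refine hχ.ne_of_isPath (by omega) huv.symm ht ?_ (Or.inr (hte' _ hre))
    (Or.inr (Sym2.eq_swap ▸ hte)) ?_
  · rw [htl, Walk.length_reverse]; omega
  · intro h
    rcases Sym2.eq_iff.1 h with h | h
    · exact hxx h.1
    · exact hxy h.1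

theorem le_ncard_of_nonbipartite_pair (hχ : RainbowCycles G χ (2 * k + 1)) (hk : 4 ≤ k)
    (hn : (4 * k + 10 : ℝ) < 1 / 10 * Fintype.card V) {Q R : Finset V} (hQR : Disjoint Q R)
    (hQ : 43 / 100 * (Fintype.card V : ℝ) ≤ Q.card) (hR : 43 / 100 * (Fintype.card V : ℝ) ≤ R.card)
    (hQm : ∀ x ∈ Q, mis G x R ≤ 1 / 100 * Fintype.card V)
    (hRm : ∀ x ∈ R, mis G x Q ≤ 1 / 100 * Fintype.card V) {u v : V} (huv : G.Adj u v)
    (hu : 15 / 100 * (Fintype.card V : ℝ) ≤ nbr G u R)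
    (hv : 15 / 100 * (Fintype.card V : ℝ) ≤ nbr G v R) :
    15 / 100 * (Fintype.card V : ℝ) ^ 2 ≤ ((χ '' G.edgeSet).ncard : ℝ) := by
  classical
  set n : ℝ := (Fintype.card V : ℝ) with hn'
  have hk4 : (4 : ℝ) ≤ k := by exact_mod_cast hk
  have hn200 : 200 ≤ n := by linarith
  have qq : ∀ x ∈ Q, ∀ y ∈ Q, RobustWalk G (1 / 10) 1 x y := by
    intro x hx y hy
    apply robustWalk_one_of_le R
    have := hQm x hx
    have := hQm y hy
    rw [nbr_eq_card_sub_mis]; linarith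
  have rr : ∀ x ∈ R, ∀ y ∈ R, RobustWalk G (1 / 10) 1 x y := by
    intro x hx y hy
    apply robustWalk_one_of_le Q
    have := hRm x hx
    have := hRm y hy
    rw [nbr_eq_card_sub_mis]; linarith
  have nQ : ∀ x ∈ Q, 1 / 10 * n + 1 ≤ nbr G x R := by
    intro x hx
    have := hQm x hx
    rw [nbr_eq_card_sub_mis]; linarith
  have nR : ∀ x ∈ R, 1 / 10 * n + 1 ≤ nbr G x Q := by
    intro x hx
    have := hRm x hx
    rw [nbr_eq_card_sub_mis]; linarith
  have all : ∀ j : ℕ, (∀ x ∈ R, ∀ y ∈ R, RobustWalk G (1 / 10) (2 * j + 1) x y) ∧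
      (∀ x ∈ R, ∀ y ∈ Q, RobustWalk G (1 / 10) (2 * j + 2) x y) := by
    have aux : ∀ j : ℕ, (∀ x ∈ R, ∀ y ∈ R, RobustWalk G (1 / 10) (2 * j + 1) x y) ∧
        (∀ x ∈ Q, ∀ y ∈ Q, RobustWalk G (1 / 10) (2 * j + 1) x y) := by
      intro j
      induction j with
      | zero => exact ⟨rr, qq⟩
      | succ j ih =>
        refine ⟨fun x hx y hy => ?_, fun x hx y hy => ?_⟩
        · refine robustWalk_succ_of_le_nbr Q (fun z hz _ => ?_) (nR x hx)
          exact robustWalk_succ_of_le_nbr R (fun z' hz' _ => ih.1 z' hz' y hy) (nQ z hz)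
        · refine robustWalk_succ_of_le_nbr R (fun z hz _ => ?_) (nQ x hx)
          exact robustWalk_succ_of_le_nbr Q (fun z' hz' _ => ih.2 z' hz' y hy) (nR z hz)
    intro j
    refine ⟨(aux j).1, fun x hx y hy => ?_⟩
    exact robustWalk_succ_of_le_nbr Q (fun z' hz' _ => (aux j).2 z' hz' y hy) (nR x hx)
  have toQ : ∀ w, 15 / 100 * n ≤ nbr G w R → ∀ j : ℕ, ∀ y ∈ Q,
      RobustWalk G (1 / 10) (2 * j + 1) w y := by
    intro w hw j y hy
    cases j with
    | zero =>
      apply robustWalk_one_of_le R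
      have := hQm y hy
      linarith
    | succ j =>
      exact robustWalk_succ_of_le_nbr R (fun z hz _ => (all j).2 z hz y hy) (by linarith)
  have toR : ∀ w, 15 / 100 * n ≤ nbr G w R → ∀ j : ℕ, ∀ y ∈ R,
      RobustWalk G (1 / 10) (2 * j + 2) w y := by
    intro w hw j y hy
    exact robustWalk_succ_of_le_nbr R (fun z hz _ => (all j).1 z hz y hy) (by linarith)
  set Q' := Q \ {u, v} with hQ'
  set R' := R \ {u, v} with hR'
  have memQ : ∀ x ∈ Q', x ∈ Q ∧ u ≠ x ∧ v ≠ x := by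
    intro x hx
    simp only [hQ', Finset.mem_sdiff, Finset.mem_insert, Finset.mem_singleton, not_or] at hx
    exact ⟨hx.1, Ne.symm hx.2.1, Ne.symm hx.2.2⟩
  have memR : ∀ x ∈ R', x ∈ R ∧ u ≠ x ∧ v ≠ x := by
    intro x hx
    simp only [hR', Finset.mem_sdiff, Finset.mem_insert, Finset.mem_singleton, not_or] at hx
    exact ⟨hx.1, Ne.symm hx.2.1, Ne.symm hx.2.2⟩
  have dj : ∀ x ∈ Q, ∀ y ∈ R, x ≠ y := fun x hx y hy h =>
    Finset.disjoint_left.1 hQR hx (h ▸ hy)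
  set O : Finset (V × V) := (Q' ×ˢ R').filter fun p => G.Adj p.1 p.2 with hO
  have memO : ∀ p ∈ O, p.1 ∈ Q' ∧ p.2 ∈ R' ∧ G.Adj p.1 p.2 := by
    intro p hp
    simpa [hO, and_assoc] using hp
  have hinj : (O.image fun p => s(p.1, p.2)).card = O.card := by
    apply Finset.card_image_of_injOn
    rintro p hp q hq h
    have hp' := memO p hp
    have hq' := memO q hq
    rcases Sym2.eq_iff.1 h with h | h
    · exact Prod.ext h.1 h.2
    · exact absurd h.1 (dj _ (memQ _ hp'.1).1 _ (memR _ hq'.2.1).1)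
  have hcol : O.card ≤ (χ '' G.edgeSet).ncard := by
    rw [← hinj]
    apply card_le_ncard_colors
    · intro e he
      obtain ⟨p, hp, rfl⟩ := Finset.mem_image.1 he
      exact (memO p hp).2.2
    · intro e he e' he' hne
      obtain ⟨⟨a₁, b₁⟩, hp, rfl⟩ := Finset.mem_image.1 he
      obtain ⟨⟨a₂, b₂⟩, hq, rfl⟩ := Finset.mem_image.1 he'
      obtain ⟨ha₁, hb₁, h₁⟩ := memO _ hp
      obtain ⟨ha₂, hb₂, h₂⟩ := memO _ hq
      dsimp only at *
      obtain ⟨ha₁, hua₁, hva₁⟩ := memQ _ ha₁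
      obtain ⟨ha₂, hua₂, hva₂⟩ := memQ _ ha₂
      obtain ⟨hb₁, hub₁, hvb₁⟩ := memR _ hb₁
      obtain ⟨hb₂, hub₂, hvb₂⟩ := memR _ hb₂
      have hab := dj _ ha₁ _ hb₂
      have hab' := dj _ ha₂ _ hb₁
      obtain ⟨j, rfl⟩ := Nat.exists_eq_add_of_le hk
      by_cases haa : a₁ = a₂
      · subst haa
        have hbb : b₁ ≠ b₂ := fun h => hne (by rw [h])
        rw [Sym2.eq_swap, Sym2.eq_swap (a := a₁)]
        refine hχ.ne_of_through_edge (i₁ := 2 * j + 2) (i₃ := 2) (l := 0) hk hn huv h₁.symm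
          h₂.symm hbb hab'.symm hab.symm ⟨hub₁, hub₂, hua₁, hua₁⟩ ⟨hvb₁, hvb₂, hva₁, hva₁⟩
          (by omega) (toR u hu j _ hb₁) (toR v hv 0 _ hb₂) ?_
        intro X h1 _ _
        exact ⟨Walk.nil, Walk.IsPath.nil, rfl, by simpa using h1⟩
      by_cases hbb : b₁ = b₂
      · subst hbb
        refine hχ.ne_of_through_edge (i₁ := 2 * (j + 1) + 1) (i₃ := 1) (l := 0) hk hn huv h₁
          h₂ haa hab hab' ⟨hua₁, hua₂, hub₁, hub₁⟩ ⟨hva₁, hva₂, hvb₁, hvb₁⟩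
          (by omega) (toQ u hu (j + 1) _ ha₁) (toQ v hv 0 _ ha₂) ?_
        intro X h1 _ _
        exact ⟨Walk.nil, Walk.IsPath.nil, rfl, by simpa using h1⟩
      · refine hχ.ne_of_through_edge (i₁ := 2 * j + 1) (i₃ := 1) (l := 2) hk hn huv h₁
          h₂ haa hab hab' ⟨hua₁, hua₂, hub₁, hub₂⟩ ⟨hva₁, hva₂, hvb₁, hvb₂⟩
          (by omega) (toQ u hu j _ ha₁) (toQ v hv 0 _ ha₂) ?_
        intro X h1 h2 hX
        refine (rr _ hb₁ _ hb₂).exists_isPath X hbb h1 h2 ?_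
        have : ((X.card + 2 : ℕ) : ℝ) ≤ ((4 * (4 + j) : ℕ) : ℝ) := by exact_mod_cast hX
        push_cast at this hn ⊢
        linarith
  have hcard2 : (({u, v} : Finset V).card : ℝ) ≤ 2 := by exact_mod_cast Finset.card_le_two
  have hQ'c : 42 / 100 * n ≤ Q'.card := by
    have h1 : Q.card ≤ Q'.card + ({u, v} : Finset V).card := by
      have := Finset.le_card_sdiff {u, v} Q
      rw [← hQ'] at this
      omega
    have h2 : (Q.card : ℝ) ≤ Q'.card + ({u, v} : Finset V).card := by exact_mod_cast h1
    linarith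
  have hR'c : 42 / 100 * n ≤ R'.card := by
    have h1 : R.card ≤ R'.card + ({u, v} : Finset V).card := by
      have := Finset.le_card_sdiff {u, v} R
      rw [← hR'] at this
      omega
    have h2 : (R.card : ℝ) ≤ R'.card + ({u, v} : Finset V).card := by exact_mod_cast h1
    linarith
  have hOc : (O.card : ℝ) = ∑ x ∈ Q', nbr G x R' := by
    simp_rw [nbr_eq_card]
    rw [← Nat.cast_sum, ← Finset.card_sigma]
    congr 1
    refine Finset.card_bij (fun p _ => ⟨p.1, p.2⟩) ?_ ?_ ?_
    · rintro ⟨x, y⟩ h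
      simpa [hO, and_assoc] using h
    · rintro ⟨x, y⟩ _ ⟨x', y'⟩ _ h
      simpa using h
    · rintro ⟨x, y⟩ h
      exact ⟨⟨x, y⟩, by simpa [hO, and_assoc] using h, rfl⟩
  have hsum : ∑ _x ∈ Q', 41 / 100 * n ≤ ∑ x ∈ Q', nbr G x R' := by
    refine Finset.sum_le_sum fun x hx => ?_
    have h1 := hQm x (memQ x hx).1
    have h2 := mis_mono (G := G) x (Finset.sdiff_subset : R' ⊆ R)
    rw [nbr_eq_card_sub_mis]; linarith
  rw [Finset.sum_const, nsmul_eq_mul] at hsum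
  have hcol' : (O.card : ℝ) ≤ ((χ '' G.edgeSet).ncard : ℝ) := by exact_mod_cast hcol
  nlinarith

theorem le_ncard_of_near_bipartite (hχ : RainbowCycles G χ (2 * k + 1)) (hk : 4 ≤ k)
    (hn : (4 * k + 10 : ℝ) < 1 / 10 * Fintype.card V) {A B : Finset V}
    (hA : 45 / 100 * (Fintype.card V : ℝ) ≤ A.card) (hB : 45 / 100 * (Fintype.card V : ℝ) ≤ B.card)
    [DecidableEq V] (hAB : ((A ∩ B).card : ℝ) ≤ 1 / 100 * Fintype.card V)
    (hm : ∑ w ∈ B, mis G w A ≤ (1 / 100 * Fintype.card V : ℝ) ^ 2)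
    (hd : ∀ x, 45 / 100 * (Fintype.card V : ℝ) ≤ nbr G x Finset.univ)
    (he : (Fintype.card V : ℝ) ^ 2 < 2 * ∑ x, nbr G x Finset.univ) :
    15 / 100 * (Fintype.card V : ℝ) ^ 2 ≤ ((χ '' G.edgeSet).ncard : ℝ) := by
  classical
  set n : ℝ := (Fintype.card V : ℝ) with hn'
  have hk4 : (4 : ℝ) ≤ k := by exact_mod_cast hk
  have hn200 : 200 ≤ n := by linarith
  have side : ∀ A B : Finset V, 45 / 100 * n ≤ A.card → ((A ∩ B).card : ℝ) ≤ 1 / 100 * n →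
      ∑ w ∈ A, mis G w B ≤ (1 / 100 * n) ^ 2 →
      43 / 100 * n ≤ (((A \ B).filter fun w => ¬ 1 / 100 * n < mis G w B).card : ℝ) := by
    intro A B hA hAB hm
    have h1 := Finset.card_filter_add_card_filter_not (s := A \ B)
      (fun w => 1 / 100 * n < mis G w B)
    have h2 := mul_card_filter_lt_le_sum (S := A \ B) (fun w _ => mis_nonneg (G := G) w B)
      (1 / 100 * n)
    have h3 : ∑ w ∈ A \ B, mis G w B ≤ ∑ w ∈ A, mis G w B :=
      Finset.sum_le_sum_of_subset_of_nonneg Finset.sdiff_subset fun w _ _ => mis_nonneg w B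
    have h4 := Finset.card_sdiff_add_card_inter A B
    have h5 : (((A \ B).filter fun w => 1 / 100 * n < mis G w B).card : ℝ) ≤ 1 / 100 * n := by
      refine le_of_mul_le_mul_left ?_ (show 0 < 1 / 100 * n by positivity)
      nlinarith
    have h1' : (((A \ B).filter fun w => 1 / 100 * n < mis G w B).card : ℝ) +
      (((A \ B).filter fun w => ¬ 1 / 100 * n < mis G w B).card : ℝ) = (A \ B).card := by
        exact_mod_cast h1
    have h4' : ((A \ B).card : ℝ) + (A ∩ B).card = A.card := by exact_mod_cast h4
    linarith
  set Q := (A \ B).filter fun w => ¬ 1 / 100 * n < mis G w B with hQ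
  set R := (B \ A).filter fun w => ¬ 1 / 100 * n < mis G w A with hR
  have hQc : 43 / 100 * n ≤ Q.card := side A B hA hAB (by rw [sum_mis_comm]; exact hm)
  have hRc : 43 / 100 * n ≤ R.card := side B A hB (by rw [Finset.inter_comm]; exact hAB) hm
  have hQA : Q ⊆ A := fun x hx => (Finset.mem_sdiff.1 (Finset.mem_filter.1 hx).1).1
  have hRB : R ⊆ B := fun x hx => (Finset.mem_sdiff.1 (Finset.mem_filter.1 hx).1).1
  have hQR : Disjoint Q R := Finset.disjoint_left.2 fun x hx hx' =>
    (Finset.mem_sdiff.1 (Finset.mem_filter.1 hx).1).2 (hRB hx')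
  have hQm : ∀ x ∈ Q, mis G x R ≤ 1 / 100 * n := fun x hx =>
    (mis_mono x hRB).trans (not_lt.1 (Finset.mem_filter.1 hx).2)
  have hRm : ∀ x ∈ R, mis G x Q ≤ 1 / 100 * n := fun x hx =>
    (mis_mono x hQA).trans (not_lt.1 (Finset.mem_filter.1 hx).2)
  have hQRc : (((Q ∪ R)ᶜ).card : ℝ) ≤ 14 / 100 * n := by
    have h1 := Finset.card_compl_add_card (Q ∪ R)
    rw [Finset.card_union_of_disjoint hQR] at h1
    have h2 : (((Q ∪ R)ᶜ).card : ℝ) + (Q.card + R.card) = n := by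
      rw [hn']; exact_mod_cast h1
    linarith
  have hsplit : ∀ x, 31 / 100 * n ≤ nbr G x Q + nbr G x R := by
    intro x
    have h1 := hd x
    have h0 : Finset.univ = (Q ∪ R)ᶜ ∪ (Q ∪ R) := (compl_sup_eq_top (x := Q ∪ R)).symm
    rw [h0] at h1
    have h2 := nbr_union_le (G := G) x ((Q ∪ R)ᶜ) (Q ∪ R)
    have h3 := nbr_union_le (G := G) x Q R
    have h4 := nbr_le_card (G := G) x ((Q ∪ R)ᶜ)
    linarith
  by_cases hL : ∃ u v, G.Adj u v ∧ 15 / 100 * n ≤ nbr G u R ∧ 15 / 100 * n ≤ nbr G v R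
  · obtain ⟨u, v, huv, hu, hv⟩ := hL
    exact le_ncard_of_nonbipartite_pair hχ hk hn hQR hQc hRc hQm hRm huv hu hv
  by_cases hL' : ∃ u v, G.Adj u v ∧ 15 / 100 * n ≤ nbr G u Q ∧ 15 / 100 * n ≤ nbr G v Q
  · obtain ⟨u, v, huv, hu, hv⟩ := hL'
    exact le_ncard_of_nonbipartite_pair hχ hk hn hQR.symm hRc hQc hRm hQm huv hu hv
  exfalso
  push Not at hL hL'
  set L := Finset.univ.filter fun x => 15 / 100 * n ≤ nbr G x R with hLdef
  have hmL : ∀ x, x ∈ L ↔ 15 / 100 * n ≤ nbr G x R := fun x => by simp [hLdef]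
  have hin : ∀ x ∈ L, nbr G x Finset.univ ≤ Lᶜ.card := by
    intro x hx
    obtain ⟨T, hT, h1, h2⟩ := exists_nbr_eq_card (G := G) x Finset.univ
    rw [h2]
    gcongr
    intro y hy
    rw [Finset.mem_compl, hmL, not_le]
    exact hL x y ((h1 y).1 hy).2 ((hmL x).1 hx)
  have hout : ∀ x ∈ Lᶜ, nbr G x Finset.univ ≤ L.card := by
    intro x hx
    obtain ⟨T, hT, h1, h2⟩ := exists_nbr_eq_card (G := G) x Finset.univ
    rw [h2]
    gcongr
    intro y hy
    by_contra hyL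
    rw [Finset.mem_compl] at hx
    rw [hmL] at hx hyL
    have h3 := hL' x y ((h1 y).1 hy).2 (by have := hsplit x; linarith)
    have := hsplit y
    linarith
  have hs := Finset.sum_add_sum_compl L (fun x => nbr G x Finset.univ)
  have h1 := Finset.sum_le_card_nsmul L (fun x => nbr G x Finset.univ) _ hin
  have h2 := Finset.sum_le_card_nsmul Lᶜ (fun x => nbr G x Finset.univ) _ hout
  rw [nsmul_eq_mul] at h1 h2
  have h3 : (L.card : ℝ) + Lᶜ.card = n := by
    rw [hn']; exact_mod_cast Finset.card_add_card_compl L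
  have := sq_nonneg ((L.card : ℝ) - Lᶜ.card)
  nlinarith

end NearBipartite

section SplitPair

variable {V : Type*} [Fintype V] [DecidableEq V] {G : SimpleGraph V} {c s t : ℝ} {χ : Sym2 V → ℕ}
  {k : ℕ}

/-- The structure found around two vertices not robustly joined by walks with three interior
vertices: `A` and `B` are their neighbourhoods, typical vertices of `A` have almost all their
neighbours in `A₂`, typical vertices of `B` have almost all their neighbours in `B₂`, and `A`, `B`
as well as `A₂`, `B₂` are almost disjoint. -/
structure SplitPair (G : SimpleGraph V) (s t : ℝ) (A B A₂ B₂ E : Finset V) : Prop where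
  le_cardA : t ≤ A.card
  le_cardB : t ≤ B.card
  card_inter : ((A ∩ B).card : ℝ) ≤ 2 * s * Fintype.card V
  card_inter₂ : ((A₂ ∩ B₂).card : ℝ) ≤ s * Fintype.card V
  le_cardA₂ : t - s * Fintype.card V ≤ A₂.card
  le_cardB₂ : t - s * Fintype.card V ≤ B₂.card
  card_E : (E.card : ℝ) ≤ 2 * s * Fintype.card V
  nbr_A : ∀ w ∈ A, w ∉ E → nbr G w A₂ᶜ ≤ s * Fintype.card V
  nbr_B : ∀ w ∈ B, w ∉ E → nbr G w B₂ᶜ ≤ s * Fintype.card V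
  nbr_not_A₂ : ∀ w, w ∉ A₂ → nbr G w A ≤ s * Fintype.card V
  nbr_not_B₂ : ∀ w, w ∉ B₂ → nbr G w B ≤ s * Fintype.card V

theorem SplitPair.symm {A B A₂ B₂ E : Finset V} (h : SplitPair G s t A B A₂ B₂ E) :
    SplitPair G s t B A B₂ A₂ E where
  le_cardA := h.le_cardB
  le_cardB := h.le_cardA
  card_inter := by rw [Finset.inter_comm]; exact h.card_inter
  card_inter₂ := by rw [Finset.inter_comm]; exact h.card_inter₂
  le_cardA₂ := h.le_cardB₂
  le_cardB₂ := h.le_cardA₂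
  card_E := h.card_E
  nbr_A := h.nbr_B
  nbr_B := h.nbr_A
  nbr_not_A₂ := h.nbr_not_B₂
  nbr_not_B₂ := h.nbr_not_A₂

theorem nbr_univ_eq (x : V) (S : Finset V) : nbr G x Finset.univ = nbr G x S + nbr G x Sᶜ := by
  rw [← nbr_union x disjoint_compl_right, Finset.union_compl]

theorem card_compl_eq (S : Finset V) : (Sᶜ.card : ℝ) = Fintype.card V - S.card := by
  have := Finset.card_add_card_compl S
  have h : (S.card : ℝ) + Sᶜ.card = Fintype.card V := by exact_mod_cast this
  linarith

theorem card_filter_lt_nbr_le {A A₂ : Finset V} [Nonempty V] (hs : 0 < s)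
    (h : ∀ w, w ∉ A₂ → nbr G w A ≤ s ^ 2 * Fintype.card V)
    [DecidablePred fun w => s * (Fintype.card V : ℝ) < nbr G w A₂ᶜ] :
    ((A.filter fun w => s * (Fintype.card V : ℝ) < nbr G w A₂ᶜ).card : ℝ)
      ≤ s * Fintype.card V := by
  have hn : (0 : ℝ) < Fintype.card V := by exact_mod_cast Fintype.card_pos
  have h1 := mul_card_filter_lt_le_sum (S := A) (fun w _ => nbr_nonneg (G := G) w A₂ᶜ)
    (s * (Fintype.card V : ℝ))
  rw [sum_nbr_comm] at h1
  have h2 := Finset.sum_le_card_nsmul A₂ᶜ (fun w => nbr G w A) _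
    (fun w hw => h w (Finset.mem_compl.1 hw))
  have h3 : (A₂ᶜ.card : ℝ) ≤ Fintype.card V := by exact_mod_cast Finset.card_le_univ _
  rw [nsmul_eq_mul] at h2
  refine le_of_mul_le_mul_left ?_ (show 0 < s * (Fintype.card V : ℝ) by positivity)
  have h4 : (A₂ᶜ.card : ℝ) * (s ^ 2 * Fintype.card V) ≤
      Fintype.card V * (s ^ 2 * Fintype.card V) := by gcongr
  nlinarith

theorem exists_splitPair (hs : 0 < s) (hs' : s ≤ 1 / 10) (hc : 0 < c) (hcs : c ≤ s ^ 4 / 2)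
    (hd : ∀ x, t ≤ nbr G x Finset.univ)
    (ht : 4 * s * Fintype.card V ≤ t)
    {x y : V} (h : ¬ RobustWalk G c 3 x y) : ∃ A B A₂ B₂ E, SplitPair G s t A B A₂ B₂ E := by
  classical
  have : Nonempty V := ⟨x⟩
  set n : ℝ := (Fintype.card V : ℝ) with hn'
  have hn0 : 0 < n := by rw [hn']; exact_mod_cast Fintype.card_pos
  obtain ⟨A, -, hA, hAc⟩ := exists_nbr_eq_card (G := G) x Finset.univ
  obtain ⟨B, -, hB, hBc⟩ := exists_nbr_eq_card (G := G) y Finset.univ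
  simp only [Finset.mem_univ, true_and] at hA hB
  set A₂ := Finset.univ.filter fun w => s ^ 2 * n ≤ nbr G w A with hA₂
  set B₂ := Finset.univ.filter fun w => s ^ 2 * n ≤ nbr G w B with hB₂
  have mA₂ : ∀ w, w ∉ A₂ → nbr G w A ≤ s ^ 2 * n := fun w hw => by
    simp only [hA₂, Finset.mem_filter, Finset.mem_univ, true_and, not_le] at hw
    exact hw.le
  have mB₂ : ∀ w, w ∉ B₂ → nbr G w B ≤ s ^ 2 * n := fun w hw => by
    simp only [hB₂, Finset.mem_filter, Finset.mem_univ, true_and, not_le] at hw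
    exact hw.le
  have hs2 : s ^ 2 ≤ s := by nlinarith
  have hs2n : s ^ 2 * n ≤ s * n := by gcongr
  have hc2 : c ≤ s ^ 2 / 2 := by
    have : s ^ 4 ≤ s ^ 2 := pow_le_pow_of_le_one hs.le (by linarith) (by norm_num)
    linarith
  have h1 : ∀ p ∈ B₂, RobustWalk G c 1 p y := by
    intro p hp
    obtain ⟨T, hT, h1, h2⟩ := exists_nbr_eq_card (G := G) p B
    refine robustWalk_succ_iff.2 ⟨T, fun z hz => ⟨((h1 z).1 hz).2, ((hB z).1 (hT hz)).symm⟩, ?_⟩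
    simp only [hB₂, Finset.mem_filter, Finset.mem_univ, true_and] at hp
    rw [← h2]
    refine le_trans ?_ hp
    have : c ≤ s ^ 2 := by nlinarith
    gcongr
  have h2 : ∀ z, c * n ≤ nbr G z (A₂ ∩ B₂) → RobustWalk G c 2 z y := by
    intro z hz
    obtain ⟨T, hT, h3, h4⟩ := exists_nbr_eq_card (G := G) z (A₂ ∩ B₂)
    refine robustWalk_succ_iff.2 ⟨T, fun p hp => ⟨((h3 p).1 hp).2, h1 p ?_⟩, ?_⟩
    · exact (Finset.mem_inter.1 (hT hp)).2
    · rw [← h4]; exact hz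
  have h3 : ((A.filter fun z => c * n ≤ nbr G z (A₂ ∩ B₂)).card : ℝ) < c * n := by
    by_contra hcon
    rw [not_lt] at hcon
    refine h (robustWalk_succ_iff.2 ⟨_, fun z hz => ?_, hcon⟩)
    rw [Finset.mem_filter] at hz
    exact ⟨(hA z).1 hz.1, h2 z hz.2⟩
  have h4 : ∑ z ∈ A, nbr G z (A₂ ∩ B₂) ≤ c * n * (A₂ ∩ B₂).card + c * n * n := by
    set F := A.filter fun z => c * n ≤ nbr G z (A₂ ∩ B₂) with hF
    have hFA : F ⊆ A := Finset.filter_subset _ _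
    rw [← Finset.sum_sdiff hFA]
    have e1 : ∑ z ∈ A \ F, nbr G z (A₂ ∩ B₂) ≤ n * (c * n) := by
      have := Finset.sum_le_card_nsmul (A \ F) (fun z => nbr G z (A₂ ∩ B₂)) (c * n) (by
        intro z hz
        simp only [hF, Finset.mem_sdiff, Finset.mem_filter, not_and, not_le] at hz
        exact (hz.2 hz.1).le)
      refine this.trans ?_
      rw [nsmul_eq_mul]
      have : ((A \ F).card : ℝ) ≤ n := by rw [hn']; exact_mod_cast Finset.card_le_univ _
      gcongr
    have e2 : ∑ z ∈ F, nbr G z (A₂ ∩ B₂) ≤ F.card * ((A₂ ∩ B₂).card : ℝ) := by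
      have := Finset.sum_le_card_nsmul F (fun z => nbr G z (A₂ ∩ B₂)) ((A₂ ∩ B₂).card : ℝ)
        (fun z _ => nbr_le_card _ _)
      rwa [nsmul_eq_mul] at this
    have e3 : F.card * ((A₂ ∩ B₂).card : ℝ) ≤ c * n * (A₂ ∩ B₂).card := by gcongr
    linarith
  have h5 : s ^ 2 * n * (A₂ ∩ B₂).card ≤ ∑ z ∈ A, nbr G z (A₂ ∩ B₂) := by
    rw [sum_nbr_comm]
    have := Finset.card_nsmul_le_sum (A₂ ∩ B₂) (fun w => nbr G w A) (s ^ 2 * n) (by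
      intro w hw
      simp only [hA₂, Finset.mem_inter, Finset.mem_filter, Finset.mem_univ, true_and] at hw
      exact hw.1)
    rw [nsmul_eq_mul] at this
    linarith
  have h6 : ((A₂ ∩ B₂).card : ℝ) ≤ s ^ 2 * n := by
    have e1 : (s ^ 2 - c) * (A₂ ∩ B₂).card ≤ c * n := by
      refine le_of_mul_le_mul_left ?_ hn0
      nlinarith
    have e2 : s ^ 2 / 2 * (A₂ ∩ B₂).card ≤ (s ^ 2 - c) * (A₂ ∩ B₂).card := by
      gcongr
      linarith
    have e3 : c * n ≤ s ^ 4 / 2 * n := by gcongr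
    refine le_of_mul_le_mul_left ?_ (show 0 < s ^ 2 / 2 by positivity)
    nlinarith
  set EA := A.filter fun w => s * n < nbr G w A₂ᶜ with hEA
  set EB := B.filter fun w => s * n < nbr G w B₂ᶜ with hEB
  have cEA : (EA.card : ℝ) ≤ s * n := card_filter_lt_nbr_le hs mA₂
  have cEB : (EB.card : ℝ) ≤ s * n := card_filter_lt_nbr_le hs mB₂
  have nA : ∀ w ∈ A, w ∉ EA → nbr G w A₂ᶜ ≤ s * n := by
    intro w hw hE
    simp only [hEA, Finset.mem_filter, not_and, not_lt] at hE
    exact hE hw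
  have nB : ∀ w ∈ B, w ∉ EB → nbr G w B₂ᶜ ≤ s * n := by
    intro w hw hE
    simp only [hEB, Finset.mem_filter, not_and, not_lt] at hE
    exact hE hw
  have cE : ((EA ∪ EB).card : ℝ) ≤ 2 * s * n := by
    have : ((EA ∪ EB).card : ℝ) ≤ EA.card + EB.card := by
      exact_mod_cast Finset.card_union_le _ _
    linarith
  have hsn : 0 < s * n := by positivity
  have exA : ∀ A EA A₂ : Finset V, t ≤ A.card → (EA.card : ℝ) ≤ s * n →
      (∀ w ∈ A, w ∉ EA → nbr G w A₂ᶜ ≤ s * n) → t - s * n ≤ A₂.card := by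
    intro A EA A₂ hA hE hAE
    obtain ⟨w, hw, hwE⟩ : ∃ w ∈ A, w ∉ EA := by
      apply Finset.exists_mem_notMem_of_card_lt_card
      have : (EA.card : ℝ) < A.card := by linarith
      exact_mod_cast this
    have e1 := hAE w hw hwE
    have e2 := hd w
    rw [nbr_univ_eq w A₂] at e2
    have e3 := nbr_le_card (G := G) w A₂
    linarith
  refine ⟨A, B, A₂, B₂, EA ∪ EB, ?_⟩
  constructor
  · rw [← hAc]; exact hd x
  · rw [← hBc]; exact hd y
  · refine le_trans ?_ cE
    gcongr
    intro w hw
    rw [Finset.mem_inter] at hw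
    by_contra hE
    rw [Finset.mem_union, not_or] at hE
    have e1 := nA w hw.1 hE.1
    have e2 := nB w hw.2 hE.2
    have e3 := hd w
    have e4 : nbr G w Finset.univ ≤ nbr G w (A₂ ∩ B₂) + nbr G w A₂ᶜ + nbr G w B₂ᶜ := by
      have e5 := nbr_union_le (G := G) w (A₂ ∩ B₂) A₂ᶜ
      have e6 := nbr_union_le (G := G) w ((A₂ ∩ B₂) ∪ A₂ᶜ) B₂ᶜ
      have e7 : (A₂ ∩ B₂) ∪ A₂ᶜ ∪ B₂ᶜ = Finset.univ := by
        ext z; simp; tauto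
      rw [e7] at e6
      linarith
    have e5 := nbr_le_card (G := G) w (A₂ ∩ B₂)
    nlinarith
  · linarith
  · exact exA A EA A₂ (by rw [← hAc]; exact hd x) cEA nA
  · exact exA B EB B₂ (by rw [← hBc]; exact hd y) cEB nB
  · exact cE
  · intro w hw hE
    exact nA w hw fun h => hE (Finset.mem_union_left _ h)
  · intro w hw hE
    exact nB w hw fun h => hE (Finset.mem_union_right _ h)
  · exact fun w hw => (mA₂ w hw).trans hs2n
  · exact fun w hw => (mB₂ w hw).trans hs2n

end SplitPair

section NearHalf

variable {V : Type*} [Fintype V] [DecidableEq V] {G : SimpleGraph V} {c s t κ δ : ℝ}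
  {χ : Sym2 V → ℕ} {k : ℕ}

theorem SplitPair.sum_mis_le {A B A₂ B₂ E P : Finset V} (h : SplitPair G (κ ^ 2) t A B A₂ B₂ E)
    (hκ : 0 < κ) (hκ' : κ ≤ 1 / 1000) (hd : ∀ x, t ≤ nbr G x Finset.univ)
    (ht : (1 / 2 - κ) * Fintype.card V ≤ t)
    (hP : (P.card : ℝ) ≤ (1 / 2 + 2 * κ) * Fintype.card V)
    (hB₂P : ((B₂ \ P).card : ℝ) ≤ 9 * κ * Fintype.card V) :
    ∑ w ∈ B, mis G w P ≤ 13 * κ * (Fintype.card V : ℝ) ^ 2 := by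
  set n : ℝ := (Fintype.card V : ℝ) with hn'
  have hn0 : 0 ≤ n := by positivity
  have hκ2 : κ ^ 2 * n ≤ 1 / 1000 * κ * n := by
    have : κ ^ 2 ≤ 1 / 1000 * κ := by nlinarith
    gcongr
  have h1 : ∀ w ∈ B \ E, mis G w P ≤ 12 * κ * n + κ ^ 2 * n := by
    intro w hw
    rw [Finset.mem_sdiff] at hw
    have e1 := h.nbr_B w hw.1 hw.2
    have e2 := hd w
    rw [nbr_univ_eq w B₂] at e2
    have e3 := nbr_mono (G := G) w (show B₂ ⊆ P ∪ B₂ \ P by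
      intro z hz; simp [hz])
    have e4 := nbr_union_le (G := G) w P (B₂ \ P)
    have e5 := nbr_le_card (G := G) w (B₂ \ P)
    unfold mis
    linarith
  have h2 : ∑ w ∈ B \ E, mis G w P ≤ n * (12 * κ * n + κ ^ 2 * n) := by
    refine (Finset.sum_le_card_nsmul _ _ _ h1).trans ?_
    rw [nsmul_eq_mul]
    have : ((B \ E).card : ℝ) ≤ n := by rw [hn']; exact_mod_cast Finset.card_le_univ _
    gcongr
  have h3 : ∑ w ∈ B ∩ E, mis G w P ≤ (2 * κ ^ 2 * n) * n := by
    refine (Finset.sum_le_card_nsmul _ _ n (fun w _ => (mis_le_card w P).trans ?_)).trans ?_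
    · rw [hn']; exact_mod_cast Finset.card_le_univ _
    · rw [nsmul_eq_mul]
      have : ((B ∩ E).card : ℝ) ≤ E.card := by
        exact_mod_cast Finset.card_le_card Finset.inter_subset_right
      have := h.card_E
      gcongr
      linarith
  have h4 := Finset.sum_inter_add_sum_sdiff B E (fun w => mis G w P)
  nlinarith

set_option maxHeartbeats 1000000 in
theorem SplitPair.sq_le_of_near_half {A B A₂ B₂ E : Finset V}
    (h : SplitPair G (κ ^ 2) t A B A₂ B₂ E) (hχ : RainbowCycles G χ (2 * k + 1)) (hk : 4 ≤ k)
    (hn : (4 * k + 10 : ℝ) < 1 / 10 * Fintype.card V) (hκ : 0 < κ) (hκ' : κ ≤ 1 / 1000)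
    (hδ : 0 < δ) (hδ' : δ ≤ 1 / 100) (hκδ : 13 * κ ≤ δ ^ 2)
    (hd : ∀ x, t ≤ nbr G x Finset.univ) (ht : (1 / 2 - κ) * Fintype.card V ≤ t)
    (he : (Fintype.card V : ℝ) ^ 2 < 2 * ∑ x, nbr G x Finset.univ) :
    ((1 / 2 - κ) * Fintype.card V) ^ 2 - 3 * δ * (Fintype.card V : ℝ) ^ 2
      ≤ 2 * ((χ '' G.edgeSet).ncard : ℝ) := by
  set n : ℝ := (Fintype.card V : ℝ) with hn'
  have hk4 : (4 : ℝ) ≤ k := by exact_mod_cast hk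
  have hn0 : 0 < n := by linarith
  have hκn : 0 < κ * n := by positivity
  have hκ2 : κ ^ 2 * n ≤ 1 / 1000 * (κ * n) := by
    have : κ ^ 2 ≤ 1 / 1000 * κ := by nlinarith
    nlinarith
  have hκn' : κ * n ≤ 1 / 1000 * n := by gcongr
  have hA := h.le_cardA
  have hB := h.le_cardB
  have hI := h.card_inter
  have hU : ((A ∪ B).card : ℝ) + (A ∩ B).card = A.card + B.card := by
    exact_mod_cast Finset.card_union_add_card_inter A B
  have hU1 : ((A ∪ B).card : ℝ) ≤ n := by rw [hn']; exact_mod_cast Finset.card_le_univ _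
  have hU2 := card_compl_eq (A ∪ B)
  have hA₂ := h.le_cardA₂
  have hB₂ := h.le_cardB₂
  have hI₂ := h.card_inter₂
  have hE := h.card_E
  have hV : ((A₂ ∪ B₂).card : ℝ) + (A₂ ∩ B₂).card = A₂.card + B₂.card := by
    exact_mod_cast Finset.card_union_add_card_inter A₂ B₂
  have hV1 : ((A₂ ∪ B₂).card : ℝ) ≤ n := by rw [hn']; exact_mod_cast Finset.card_le_univ _
  have cover : ∀ P P' : Finset V, P ∪ P' = A ∪ B → ((P' ∩ B₂).card : ℝ) < 6 * κ * n →
      ((B₂ \ P).card : ℝ) ≤ 9 * κ * n := by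
    intro P P' hPP hP'
    have e1 : B₂ \ P ⊆ (P' ∩ B₂) ∪ (A ∪ B)ᶜ := by
      intro z hz
      rw [← hPP]
      simp only [Finset.mem_sdiff, Finset.mem_union, Finset.mem_inter, Finset.mem_compl] at hz ⊢
      tauto
    have e2 : ((B₂ \ P).card : ℝ) ≤ (P' ∩ B₂).card + ((A ∪ B)ᶜ).card := by
      exact_mod_cast (Finset.card_le_card e1).trans (Finset.card_union_le _ _)
    linarith
  have hsq : 13 * κ * n ^ 2 ≤ δ ^ 2 * n ^ 2 := by gcongr
  by_cases hY : ((A ∩ B₂).card : ℝ) < 6 * κ * n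
  · have h1 := h.sum_mis_le (P := B) hκ hκ' hd ht (by linarith)
      (cover B A (Finset.union_comm _ _) hY)
    have h2 := sq_card_le_of_near_clique hχ hk hn hδ (by linarith) (by linarith) (h1.trans hsq)
    have h3 : ((1 / 2 - κ) * n) ^ 2 ≤ (B.card : ℝ) ^ 2 := by
      have : 0 ≤ (1 / 2 - κ) * n := by nlinarith
      gcongr
      linarith
    linarith
  by_cases hX : ((B ∩ B₂).card : ℝ) < 6 * κ * n
  · have h1 := h.sum_mis_le (P := A) hκ hκ' hd ht (by linarith) (cover A B rfl hX)
    have h2 := le_ncard_of_near_bipartite hχ hk hn (A := A) (B := B) (by linarith) (by linarith)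
      (by linarith) (by
        refine h1.trans (hsq.trans ?_)
        rw [mul_pow]
        gcongr) (fun x => by have := hd x; linarith) he
    have h3 : ((1 / 2 - κ) * n) ^ 2 ≤ 1 / 4 * n ^ 2 := by
      rw [mul_pow]; gcongr; nlinarith
    have h4 : 0 < δ * n ^ 2 := by positivity
    have h5 : 0 < n ^ 2 := by positivity
    linarith
  exfalso
  rw [not_lt] at hX hY
  set X := B ∩ B₂ with hXdef
  set Y := A ∩ B₂ with hYdef
  have h1 : ∀ y ∈ Y \ E, nbr G y X ≤ 2 * κ ^ 2 * n := by
    intro y hy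
    rw [Finset.mem_sdiff, hYdef, Finset.mem_inter] at hy
    have e1 := h.nbr_A y hy.1.1 hy.2
    have e2 : X ⊆ (A₂ ∩ B₂) ∪ A₂ᶜ := by
      intro z hz
      rw [hXdef, Finset.mem_inter] at hz
      simp only [Finset.mem_union, Finset.mem_inter, Finset.mem_compl]
      tauto
    have e3 := nbr_mono (G := G) y e2
    have e4 := nbr_union_le (G := G) y (A₂ ∩ B₂) A₂ᶜ
    have e5 := nbr_le_card (G := G) y (A₂ ∩ B₂)
    linarith
  have h2 : ∀ x ∈ X \ E, (Y.card : ℝ) - 3 * κ * n ≤ nbr G x Y := by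
    intro x hx
    rw [Finset.mem_sdiff, hXdef, Finset.mem_inter] at hx
    have e1 := h.nbr_B x hx.1.1 hx.2
    have e2 := hd x
    rw [nbr_univ_eq x B₂] at e2
    have e3 := mis_mono (G := G) x (show Y ⊆ B₂ from Finset.inter_subset_right)
    unfold mis at e3
    linarith
  have h3 : ∑ y ∈ Y, nbr G y X ≤ 4 * κ ^ 2 * n * n := by
    have e1 : ∑ y ∈ Y \ E, nbr G y X ≤ n * (2 * κ ^ 2 * n) := by
      refine (Finset.sum_le_card_nsmul _ _ _ h1).trans ?_
      rw [nsmul_eq_mul]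
      have : ((Y \ E).card : ℝ) ≤ n := by rw [hn']; exact_mod_cast Finset.card_le_univ _
      gcongr
    have e2 : ∑ y ∈ Y ∩ E, nbr G y X ≤ (2 * κ ^ 2 * n) * n := by
      refine (Finset.sum_le_card_nsmul _ _ n (fun w _ => (nbr_le_card w X).trans ?_)).trans ?_
      · rw [hn']; exact_mod_cast Finset.card_le_univ _
      · rw [nsmul_eq_mul]
        have : ((Y ∩ E).card : ℝ) ≤ E.card := by
          exact_mod_cast Finset.card_le_card Finset.inter_subset_right
        gcongr
        linarith
    have e3 := Finset.sum_inter_add_sum_sdiff Y E (fun w => nbr G w X)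
    linarith
  have h4 : ((X \ E).card : ℝ) * (Y.card - 3 * κ * n) ≤ ∑ x ∈ X, nbr G x Y := by
    have e1 := Finset.card_nsmul_le_sum (X \ E) (fun x => nbr G x Y) _ h2
    rw [nsmul_eq_mul] at e1
    refine e1.trans (Finset.sum_le_sum_of_subset_of_nonneg Finset.sdiff_subset
      fun w _ _ => nbr_nonneg w Y)
  rw [sum_nbr_comm] at h4
  have h5 : (X.card : ℝ) ≤ (X \ E).card + E.card := by
    have : X.card ≤ (X \ E).card + E.card := by
      have := Finset.le_card_sdiff E X
      omega
    exact_mod_cast this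
  have h6 : 5 * κ * n ≤ (X \ E).card := by linarith
  have h7 : 3 * κ * n ≤ Y.card - 3 * κ * n := by linarith
  have h8 : (5 * κ * n) * (3 * κ * n) ≤ ((X \ E).card : ℝ) * (Y.card - 3 * κ * n) := by
    gcongr
  have h9 : 0 < κ ^ 2 * n * n := by positivity
  linarith

theorem sq_le_of_not_shortLinked (hχ : RainbowCycles G χ (2 * k + 1)) (hk : 4 ≤ k)
    (hn : (4 * k + 10 : ℝ) < 1 / 10 * Fintype.card V) (hκ : 0 < κ) (hκ' : κ ≤ 1 / 1000)
    (hc : 0 < c) (hcκ : c ≤ κ)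
    (hδ : 0 < δ) (hδ' : δ ≤ 1 / 100) (hκδ : 13 * κ ≤ δ ^ 2)
    (hd : ∀ x, t ≤ nbr G x Finset.univ) (ht : (1 / 2 - κ) * Fintype.card V ≤ t)
    {x y : V} (hxy : ¬ ShortLinked G c x y) :
    ((1 / 2 - κ) * Fintype.card V) ^ 2 - 3 * δ * (Fintype.card V : ℝ) ^ 2
      ≤ 2 * ((χ '' G.edgeSet).ncard : ℝ) := by
  set n : ℝ := (Fintype.card V : ℝ) with hn'
  have hk4 : (4 : ℝ) ≤ k := by exact_mod_cast hk
  have hn0 : 0 < n := by linarith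
  have hκn' : κ * n ≤ 1 / 1000 * n := by gcongr
  have hcn : c * n ≤ κ * n := by gcongr
  have hcn0 : 0 < c * n := by positivity
  obtain ⟨A, -, hA, hAc⟩ := exists_nbr_eq_card (G := G) x Finset.univ
  obtain ⟨B, -, hB, hBc⟩ := exists_nbr_eq_card (G := G) y Finset.univ
  simp only [Finset.mem_univ, true_and] at hA hB
  have hAt := hd x
  have hBt := hd y
  rw [hAc] at hAt
  rw [hBc] at hBt
  have hI : ((A ∩ B).card : ℝ) ≤ c * n := by
    by_contra hcon
    rw [not_le] at hcon
    refine hxy (Or.inl (robustWalk_succ_iff.2 ⟨A ∩ B, fun z hz => ?_, hcon.le⟩))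
    rw [Finset.mem_inter] at hz
    exact ⟨(hA z).1 hz.1, ((hB z).1 hz.2).symm⟩
  classical
  set F := A.filter fun z => c * n ≤ nbr G z B with hF
  have hFc : (F.card : ℝ) ≤ c * n := by
    by_contra hcon
    rw [not_le] at hcon
    refine hxy (Or.inr (Or.inl (robustWalk_succ_iff.2 ⟨F, fun z hz => ?_, hcon.le⟩)))
    rw [hF, Finset.mem_filter] at hz
    refine ⟨(hA z).1 hz.1, ?_⟩
    obtain ⟨T, hT, h1, h2⟩ := exists_nbr_eq_card (G := G) z B
    refine robustWalk_succ_iff.2 ⟨T, fun w hw => ⟨((h1 w).1 hw).2, ((hB w).1 (hT hw)).symm⟩, ?_⟩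
    rw [← h2]; exact hz.2
  have hU : ((A ∪ B).card : ℝ) + (A ∩ B).card = A.card + B.card := by
    exact_mod_cast Finset.card_union_add_card_inter A B
  have hU1 : ((A ∪ B).card : ℝ) ≤ n := by rw [hn']; exact_mod_cast Finset.card_le_univ _
  have hU2 := card_compl_eq (A ∪ B)
  have h1 : ∀ w ∈ A \ F, mis G w A ≤ 7 * κ * n := by
    intro w hw
    simp only [hF, Finset.mem_sdiff, Finset.mem_filter, not_and, not_le] at hw
    have e1 := hw.2 hw.1
    have e2 := hd w
    have e3 := nbr_union_le (G := G) w A B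
    have e4 := nbr_univ_eq (G := G) w (A ∪ B)
    have e5 := nbr_le_card (G := G) w (A ∪ B)ᶜ
    unfold mis
    linarith
  have h2 : ∑ w ∈ A \ F, mis G w A ≤ n * (7 * κ * n) := by
    refine (Finset.sum_le_card_nsmul _ _ _ h1).trans ?_
    rw [nsmul_eq_mul]
    have : ((A \ F).card : ℝ) ≤ n := by rw [hn']; exact_mod_cast Finset.card_le_univ _
    gcongr
  have h3 : ∑ w ∈ F, mis G w A ≤ (κ * n) * n := by
    refine (Finset.sum_le_card_nsmul _ _ n (fun w _ => (mis_le_card w A).trans ?_)).trans ?_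
    · rw [hn']; exact_mod_cast Finset.card_le_univ _
    · rw [nsmul_eq_mul]
      gcongr
      linarith
  have h4 := Finset.sum_sdiff (f := fun w => mis G w A) (show F ⊆ A from Finset.filter_subset _ _)
  have hsq : 13 * κ * n ^ 2 ≤ δ ^ 2 * n ^ 2 := by gcongr
  have h5 : 0 < κ * n ^ 2 := by positivity
  have h6 := sq_card_le_of_near_clique hχ hk hn hδ (by linarith) (P := A) (by linarith)
    (by nlinarith)
  have h7 : ((1 / 2 - κ) * n) ^ 2 ≤ (A.card : ℝ) ^ 2 := by
    have : 0 ≤ (1 / 2 - κ) * n := by nlinarith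
    gcongr
    linarith
  linarith

theorem sq_le_of_near_half (hχ : RainbowCycles G χ (2 * k + 1)) (hk : 4 ≤ k)
    (hκ : 0 < κ) (hκ' : κ ≤ 1 / 1000) (hc : 0 < c) (hcκ : c ≤ (κ ^ 2) ^ 4 / 2)
    (hn : (4 * k + 10 : ℝ) < c * Fintype.card V)
    (hδ : 0 < δ) (hδ' : δ ≤ 1 / 100) (hκδ : 13 * κ ≤ δ ^ 2)
    (hd : ∀ x, t ≤ nbr G x Finset.univ) (ht : (1 / 2 - κ) * Fintype.card V ≤ t)
    (he : (Fintype.card V : ℝ) ^ 2 < 2 * ∑ x, nbr G x Finset.univ) :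
    ((1 / 2 - κ) * Fintype.card V) ^ 2 - 3 * δ * (Fintype.card V : ℝ) ^ 2
      ≤ 2 * ((χ '' G.edgeSet).ncard : ℝ) := by
  set n : ℝ := (Fintype.card V : ℝ) with hn'
  have hk4 : (4 : ℝ) ≤ k := by exact_mod_cast hk
  have hn0 : 0 ≤ n := by positivity
  have hκ2 : κ ^ 2 ≤ 1 / 1000 * κ := by nlinarith
  have hcκ' : c ≤ κ := by
    have : (κ ^ 2) ^ 4 ≤ κ ^ 2 := by
      calc (κ ^ 2) ^ 4 ≤ (κ ^ 2) ^ 1 := pow_le_pow_of_le_one (by positivity) (by nlinarith) (by norm_num)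
        _ = κ ^ 2 := pow_one _
    nlinarith
  have hn10 : (4 * k + 10 : ℝ) < 1 / 10 * n := by
    refine hn.trans_le ?_
    gcongr
    linarith
  have hcn : c * n ≤ 1 / 1000 * n := by gcongr; linarith
  have hκn' : κ * n ≤ 1 / 1000 * n := by gcongr
  have hκ2n : κ ^ 2 * n ≤ 1 / 1000 * κ * n := by gcongr
  by_cases h3 : ∃ x y, ¬ RobustWalk G c 3 x y
  · obtain ⟨x, y, hxy⟩ := h3
    obtain ⟨A, B, A₂, B₂, E, h⟩ := exists_splitPair (s := κ ^ 2) (t := t) (by positivity)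
      (by nlinarith) hc hcκ hd (by linarith) hxy
    exact h.sq_le_of_near_half hχ hk hn10 hκ hκ' hδ hδ' hκδ hd ht he
  by_cases h2 : ∃ x y, ¬ ShortLinked G c x y
  · obtain ⟨x, y, hxy⟩ := h2
    exact sq_le_of_not_shortLinked hχ hk hn10 hκ hκ' hc hcκ' hδ hδ' hκδ hd ht hxy
  push Not at h2 h3
  have := sum_nbr_le_ncard_colors (Q := Finset.univ) (C := ∅) hχ hk hn (fun x _ y _ _ => h3 x y)
    (fun x _ => by have := hd x; linarith) (fun x _ _ y _ _ _ => h2 x y)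
  simp only [Finset.card_empty, Nat.cast_zero, ne_eq, OfNat.ofNat_ne_zero, not_false_eq_true,
    zero_pow, add_zero] at this
  have h5 : ((1 / 2 - κ) * n) ^ 2 ≤ 1 / 4 * n ^ 2 := by
    rw [mul_pow]; gcongr; nlinarith
  have h4 : 0 < δ * n ^ 2 := by
    have : 0 < n := by linarith
    positivity
  linarith

end NearHalf

section ConflictSet

variable {V : Type*} [Fintype V] [DecidableEq V] {G : SimpleGraph V} {c t κ η : ℝ}

theorem exists_of_not_shortLinked {x y : V} (hxy : ¬ ShortLinked G c x y) :
    ∃ A B F : Finset V, (∀ z, z ∈ A ↔ G.Adj x z) ∧ (∀ z, z ∈ B ↔ G.Adj y z) ∧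
      ((A ∩ B).card : ℝ) ≤ c * Fintype.card V ∧ (F.card : ℝ) ≤ 2 * (c * Fintype.card V) ∧
      (∀ w ∈ A, w ∉ F → nbr G w B ≤ c * Fintype.card V) ∧
      (∀ w ∈ B, w ∉ F → nbr G w A ≤ c * Fintype.card V) := by
  classical
  set n : ℝ := (Fintype.card V : ℝ) with hn'
  obtain ⟨A, -, hA, -⟩ := exists_nbr_eq_card (G := G) x Finset.univ
  obtain ⟨B, -, hB, -⟩ := exists_nbr_eq_card (G := G) y Finset.univ
  simp only [Finset.mem_univ, true_and] at hA hB
  have key : ∀ (x y : V) (A B : Finset V), (∀ z, z ∈ A ↔ G.Adj x z) → (∀ z, z ∈ B ↔ G.Adj y z) →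
      ¬ RobustWalk G c 2 x y → ((A.filter fun z => c * n ≤ nbr G z B).card : ℝ) ≤ c * n := by
    intro x y A B hA hB h
    by_contra hcon
    rw [not_le] at hcon
    refine h (robustWalk_succ_iff.2 ⟨_, fun z hz => ?_, hcon.le⟩)
    rw [Finset.mem_filter] at hz
    refine ⟨(hA z).1 hz.1, ?_⟩
    obtain ⟨T, hT, h1, h2⟩ := exists_nbr_eq_card (G := G) z B
    refine robustWalk_succ_iff.2 ⟨T, fun w hw => ⟨((h1 w).1 hw).2, ((hB w).1 (hT hw)).symm⟩, ?_⟩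
    rw [← h2]; exact hz.2
  simp only [ShortLinked, not_or] at hxy
  have h1 := key x y A B hA hB hxy.2.1
  have h2 := key y x B A hB hA hxy.2.2
  refine ⟨A, B, (A.filter fun z => c * n ≤ nbr G z B) ∪ (B.filter fun z => c * n ≤ nbr G z A),
    hA, hB, ?_, ?_, ?_, ?_⟩
  · by_contra hcon
    rw [not_le] at hcon
    refine hxy.1 (robustWalk_succ_iff.2 ⟨A ∩ B, fun z hz => ?_, hcon.le⟩)
    rw [Finset.mem_inter] at hz
    exact ⟨(hA z).1 hz.1, ((hB z).1 hz.2).symm⟩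
  · have h3 := Finset.card_union_le (A.filter fun z => c * n ≤ nbr G z B)
      (B.filter fun z => c * n ≤ nbr G z A)
    have h4 : (((A.filter fun z => c * n ≤ nbr G z B) ∪
      (B.filter fun z => c * n ≤ nbr G z A)).card : ℝ) ≤
      (A.filter fun z => c * n ≤ nbr G z B).card + (B.filter fun z => c * n ≤ nbr G z A).card := by
        exact_mod_cast h3
    linarith
  · intro w hw hwF
    simp only [Finset.mem_union, Finset.mem_filter, not_or, not_and, not_le] at hwF
    exact (hwF.1 hw).le
  · intro w hw hwF
    simp only [Finset.mem_union, Finset.mem_filter, not_or, not_and, not_le] at hwF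
    exact (hwF.2 hw).le

theorem conflict_arith {n t κ η c b a σ E T : ℝ} (hn : 0 < n) (hη : 0 < η)
    (hη1 : η ≤ 1) (hηκ : η ≤ κ) (hc : 0 < c) (hcη : c ≤ η ^ 2 * κ / 20) (hcn : 10 < c * n)
    (ht0 : 0 ≤ t) (htκ : t ≤ (1 / 2 - κ) * n) (hbt : t ≤ b) (hbn : b ≤ n) (hab : b ≤ a)
    (hσ : t + η * n ≤ σ) (hσ' : σ ≤ t + η * n + 1) (hE : 0 ≤ E)
    (hE' : η * E ≤ 4 * (c * n))
    (hT : T ≤ 2 * t * (n - t) + n)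
    (hT' : σ * (n - b) + (n - σ - E) * (t - c * n) + (b - t) * (a + b - c * n - σ - E) ≤ T) :
    False := by
  have h1 : (t + η * n) * (n - 2 * b) - n ≤ σ * (n - 2 * b) := by
    have h : (σ - (t + η * n)) * (n - 2 * b) ≥ - n := by
      rcases le_total 0 (n - 2 * b) with h | h
      · have := mul_nonneg (sub_nonneg.2 hσ) h
        linarith
      · have h3 : 0 ≤ (1 - (σ - (t + η * n))) * (2 * b - n) :=
          mul_nonneg (by linarith) (by linarith)
        linarith
    linarith
  have h2 : (b - t) * (2 * b) ≤ (b - t) * (a + b) :=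
    mul_le_mul_of_nonneg_left (by linarith) (by linarith)
  have hc0 : 0 ≤ c * n := by positivity
  have h3 : (n - σ) * (c * n) ≤ n * (c * n) :=
    mul_le_mul_of_nonneg_right (by nlinarith [mul_pos hη hn]) hc0
  have htn : t ≤ n := by linarith
  have h4 : E * (t - c * n) ≤ E * n := mul_le_mul_of_nonneg_left (by linarith) hE
  have h5 : (b - t) * (c * n + E) ≤ n * (c * n + E) :=
    mul_le_mul_of_nonneg_right (by linarith) (by linarith)
  have h6 : 2 * t * (n - t) + 2 * (b - t) ^ 2 + η * n * (n - 2 * b) - n - 2 * (c * n + E) * n ≤ T := by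
    linarith
  have h7 : η * κ * n ^ 2 ≤ 2 * (b - t) ^ 2 + η * n * (n - 2 * b) := by
    have e1 : 2 * κ * n - 2 * (b - t) ≤ n - 2 * b := by linarith
    have e2 : η * n * (2 * κ * n - 2 * (b - t)) ≤ η * n * (n - 2 * b) :=
      mul_le_mul_of_nonneg_left e1 (by positivity)
    have e3 : η * η * n ^ 2 ≤ η * κ * n ^ 2 := by gcongr
    nlinarith [sq_nonneg (b - t - η * n / 2)]
  have h8 : η * κ * n ^ 2 ≤ 2 * n + 2 * (c * n + E) * n := by linarith
  have h9 : η * κ * n ≤ 2 + 2 * (c * n + E) := by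
    refine le_of_mul_le_mul_right ?_ hn
    linarith
  have h10 : η * (η * κ * n) ≤ η * (2 + 2 * (c * n + E)) := mul_le_mul_of_nonneg_left h9 hη.le
  have h11 : c * n ≤ η ^ 2 * κ / 20 * n := by gcongr
  have h12 : η * (c * n) ≤ 1 * (c * n) := by gcongr
  nlinarith

theorem exists_conflict_set (hκ : 0 < κ) (hκ1 : κ ≤ 1) (hη : 0 < η) (hηκ : η ≤ κ) (hc : 0 < c)
    (hcη : c ≤ η ^ 2 * κ / 20) (hcn : 10 < c * Fintype.card V)
    (hct : c * Fintype.card V ≤ t) (htκ : t ≤ (1 / 2 - κ) * Fintype.card V)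
    (hd : ∀ x, t ≤ nbr G x Finset.univ)
    (hT : ∑ x, mis G x Finset.univ ≤ 2 * t * (Fintype.card V - t) + Fintype.card V) :
    ∃ C : Finset V, (C.card : ℝ) ≤ t + η * Fintype.card V ∧
      ∀ x, x ∉ C → ∀ y, y ∉ C → x ≠ y → ShortLinked G c x y := by
  classical
  set n : ℝ := (Fintype.card V : ℝ) with hn'
  have hn0 : 0 < n := by
    by_contra h
    rw [not_lt] at h
    nlinarith
  have hη1 : η ≤ 1 := by linarith
  set C := Finset.univ.filter fun y => ∃ x, (¬ ShortLinked G c x y ∨ ¬ ShortLinked G c y x) ∧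
    nbr G y Finset.univ ≤ nbr G x Finset.univ with hC
  refine ⟨C, ?_, ?_⟩
  swap
  · intro x hx y hy hxy
    simp only [hC, Finset.mem_filter, Finset.mem_univ, true_and, not_exists, not_and, not_le] at hx hy
    by_contra h
    have h1 := hx y (Or.inr h)
    have h2 := hy x (Or.inl h)
    linarith
  by_contra hcon
  rw [not_le] at hcon
  have hσC : ⌈t + η * n⌉₊ ≤ C.card := Nat.ceil_le.2 hcon.le
  obtain ⟨Z, hZC, hZ⟩ := Finset.exists_subset_card_eq hσC
  have ht0 : 0 ≤ t := by linarith
  have hσ1 : t + η * n ≤ Z.card := by rw [hZ]; exact Nat.le_ceil _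
  have hσ2 : (Z.card : ℝ) ≤ t + η * n + 1 := by
    rw [hZ]; exact (Nat.ceil_lt_add_one (by positivity)).le
  have hZn : (Z.card : ℝ) ≤ n := by rw [hn']; exact_mod_cast Finset.card_le_univ _
  have hpair : ∀ y ∈ Z, ∃ A B F : Finset V, (∀ z, z ∈ B ↔ G.Adj y z) ∧
      nbr G y Finset.univ ≤ A.card ∧ t ≤ A.card ∧ (B.card : ℝ) = nbr G y Finset.univ ∧
      ((A ∩ B).card : ℝ) ≤ c * n ∧ (F.card : ℝ) ≤ 2 * (c * n) ∧
      (∀ w ∈ A, w ∉ F → nbr G w B ≤ c * n) ∧ (∀ w ∈ B, w ∉ F → nbr G w A ≤ c * n) := by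
    intro y hy
    have hyC := hZC hy
    simp only [hC, Finset.mem_filter, Finset.mem_univ, true_and] at hyC
    obtain ⟨x, hx, hdeg⟩ := hyC
    have hcardN : ∀ (x : V) (A : Finset V), (∀ z, z ∈ A ↔ G.Adj x z) →
        (A.card : ℝ) = nbr G x Finset.univ := by
      intro x A hA
      obtain ⟨T, -, h1, h2⟩ := exists_nbr_eq_card (G := G) x Finset.univ
      have : A = T := by
        ext z; rw [hA, h1]; simp
      rw [h2, this]
    rcases hx with hx | hx
    · obtain ⟨A, B, F, hA, hB, h1, h2, h3, h4⟩ := exists_of_not_shortLinked hx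
      refine ⟨A, B, F, hB, ?_, ?_, hcardN y B hB, h1, h2, h3, h4⟩
      · rwa [hcardN x A hA]
      · rw [hcardN x A hA]; exact hd x
    · obtain ⟨B, A, F, hB, hA, h1, h2, h3, h4⟩ := exists_of_not_shortLinked hx
      refine ⟨A, B, F, hB, ?_, ?_, hcardN y B hB, by rwa [Finset.inter_comm], h2, h4, h3⟩
      · rwa [hcardN x A hA]
      · rw [hcardN x A hA]; exact hd x
  choose! A B F hB hdA htA hBd hAB hF hAF hBF using hpair
  set X := Finset.univ.filter fun w => η * n < ((Z.filter fun y => w ∈ F y).card : ℝ) with hX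
  have hXc : η * (X.card : ℝ) ≤ 2 * (c * n) := by
    have e1 := mul_card_filter_lt_le_sum (S := Finset.univ)
      (f := fun w => ((Z.filter fun y => w ∈ F y).card : ℝ)) (fun w _ => Nat.cast_nonneg _) (η * n)
    have e2 : ∑ w, ((Z.filter fun y => w ∈ F y).card : ℝ) = ∑ y ∈ Z, ((F y).card : ℝ) := by
      have := Finset.sum_card_bipartiteAbove_eq_sum_card_bipartiteBelow (s := Finset.univ) (t := Z)
        (fun w y => w ∈ F y)
      simp only [Finset.bipartiteAbove, Finset.bipartiteBelow, Finset.filter_univ_mem] at this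
      exact_mod_cast this
    have e3 := Finset.sum_le_card_nsmul Z (fun y => ((F y).card : ℝ)) _ hF
    rw [nsmul_eq_mul] at e3
    have e4 : (Z.card : ℝ) * (2 * (c * n)) ≤ n * (2 * (c * n)) := by gcongr
    refine le_of_mul_le_mul_left ?_ hn0
    rw [e2] at e1
    linarith
  obtain ⟨y, hyZ, hymax⟩ := Finset.exists_max_image Z (fun y => nbr G y Finset.univ) (by
    rw [← Finset.card_pos]
    have : (0 : ℝ) < Z.card := by
      have : 0 < η * n := by positivity
      linarith
    exact_mod_cast this)
  set b := nbr G y Finset.univ with hb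
  set E := X ∪ F y with hE
  have hEc : η * (E.card : ℝ) ≤ 4 * (c * n) := by
    have e1 : (E.card : ℝ) ≤ X.card + (F y).card := by exact_mod_cast Finset.card_union_le _ _
    have e2 := hF y hyZ
    have e3 : η * (E.card : ℝ) ≤ η * (X.card + (F y).card) := by gcongr
    have e4 : η * ((F y).card : ℝ) ≤ 1 * (2 * (c * n)) := by gcongr
    linarith
  have hbt : t ≤ b := hd y
  have r1 : ∀ w ∈ Z, n - b ≤ mis G w Finset.univ := by
    intro w hw
    have := hymax w hw
    rw [mis, Finset.card_univ]
    linarith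
  have r2 : ∀ w ∈ Zᶜ \ E, t - c * n ≤ mis G w Finset.univ := by
    intro w hw
    simp only [Finset.mem_sdiff, Finset.mem_compl, hE, Finset.mem_union, not_or] at hw
    have hwX := hw.2.1
    simp only [hX, Finset.mem_filter, Finset.mem_univ, true_and, not_lt] at hwX
    by_cases h : ∃ z ∈ Z, G.Adj w z ∧ w ∉ F z
    · obtain ⟨z, hz, hwz, hwF⟩ := h
      have e1 := hBF z hz w ((hB z hz w).2 hwz.symm) hwF
      have e2 := htA z hz
      have e3 := mis_univ_ge (G := G) w (A z)
      linarith
    · push Not at h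
      have e1 : nbr G w Z ≤ (Z.filter fun y => w ∈ F y).card := by
        rw [nbr_eq_card]
        gcongr 1
        apply Finset.card_le_card
        intro z hz
        rw [Finset.mem_filter] at hz ⊢
        exact ⟨hz.1, h z hz.1 hz.2⟩
      have e3 := mis_univ_ge (G := G) w Z
      have e4 : 0 < c * n := by positivity
      linarith
  have r3 : ∀ w ∈ (A y ∪ B y) \ (Z ∪ E), b - c * n ≤ mis G w Finset.univ := by
    intro w hw
    simp only [Finset.mem_sdiff, hE, Finset.mem_union, not_or] at hw
    rcases hw.1 with h | h
    · have e1 := hAF y hyZ w h hw.2.2.2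
      have e2 := hBd y hyZ
      have e3 := mis_univ_ge (G := G) w (B y)
      linarith
    · have e1 := hBF y hyZ w h hw.2.2.2
      have e2 := hdA y hyZ
      have e3 := mis_univ_ge (G := G) w (A y)
      linarith
  set U := (A y ∪ B y) \ (Z ∪ E) with hU
  have hUZ : U ⊆ Zᶜ \ E := by
    intro w hw
    simp only [hU, Finset.mem_sdiff, Finset.mem_union, not_or, Finset.mem_compl] at hw ⊢
    exact hw.2
  have hUc : ((A y).card : ℝ) + b - c * n - Z.card - E.card ≤ U.card := by
    have e1 : (A y ∪ B y).card ≤ U.card + (Z ∪ E).card := by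
      have := Finset.le_card_sdiff (Z ∪ E) (A y ∪ B y)
      rw [← hU] at this
      omega
    have e2 := Finset.card_union_le Z E
    have e3 := Finset.card_union_add_card_inter (A y) (B y)
    have e4 : ((A y).card : ℝ) + (B y).card ≤ U.card + (Z.card + E.card) + (A y ∩ B y).card := by
      have : (A y).card + (B y).card ≤ U.card + (Z.card + E.card) + (A y ∩ B y).card := by omega
      exact_mod_cast this
    have e5 := hAB y hyZ
    have e6 := hBd y hyZ
    linarith
  have hWc : n - Z.card - E.card ≤ (Zᶜ \ E).card := by
    have e1 := card_compl_eq Z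
    have e2 : (Zᶜ.card : ℝ) ≤ (Zᶜ \ E).card + E.card := by
      have : Zᶜ.card ≤ (Zᶜ \ E).card + E.card := by
        have := Finset.le_card_sdiff E Zᶜ
        omega
      exact_mod_cast this
    linarith
  have s1 : (Z.card : ℝ) * (n - b) ≤ ∑ w ∈ Z, mis G w Finset.univ := by
    have := Finset.card_nsmul_le_sum Z (fun w => mis G w Finset.univ) _ r1
    rwa [nsmul_eq_mul] at this
  have s2 : ((Zᶜ \ E).card : ℝ) * (t - c * n) + U.card * (b - t) ≤
      ∑ w ∈ Zᶜ \ E, mis G w Finset.univ := by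
    have e1 := Finset.card_nsmul_le_sum U (fun w => mis G w Finset.univ) _ r3
    have e2 := Finset.card_nsmul_le_sum ((Zᶜ \ E) \ U) (fun w => mis G w Finset.univ) (t - c * n)
      (fun w hw => r2 w (Finset.mem_sdiff.1 hw).1)
    rw [nsmul_eq_mul] at e1 e2
    have e3 := Finset.sum_sdiff (f := fun w => mis G w Finset.univ) hUZ
    have e4 : (((Zᶜ \ E) \ U).card : ℝ) + U.card = (Zᶜ \ E).card := by
      exact_mod_cast Finset.card_sdiff_add_card_eq_card hUZ
    rw [← e3, ← e4]
    linarith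
  have s3 : ∑ w ∈ Zᶜ \ E, mis G w Finset.univ ≤ ∑ w ∈ Zᶜ, mis G w Finset.univ :=
    Finset.sum_le_sum_of_subset_of_nonneg Finset.sdiff_subset fun w _ _ => mis_nonneg w _
  have s4 := Finset.sum_add_sum_compl Z (fun w => mis G w Finset.univ)
  have s5 : (n - Z.card - E.card) * (t - c * n) ≤ ((Zᶜ \ E).card : ℝ) * (t - c * n) :=
    mul_le_mul_of_nonneg_right hWc (by linarith)
  have s6 : (b - t) * ((A y).card + b - c * n - Z.card - E.card) ≤ (b - t) * U.card :=
    mul_le_mul_of_nonneg_left hUc (by linarith)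
  have hbn : b ≤ n := by
    have := nbr_le_card (G := G) y Finset.univ
    rwa [Finset.card_univ] at this
  exact conflict_arith hn0 hη hη1 hηκ hc hcη hcn ht0 htκ hbt hbn (hdA y hyZ) hσ1 hσ2
    (Nat.cast_nonneg _) hEc hT (by linarith)

end ConflictSet

section Exceptional

variable {V : Type*} [Fintype V] [DecidableEq V] {G : SimpleGraph V} {c s t κ τ ρ θ δ : ℝ}
  {χ : Sym2 V → ℕ} {k : ℕ}

theorem robustWalk_add_two_of_le {i : ℕ} {x y : V} {μ ν : ℝ} (M : Finset V)
    (hM : ∀ z ∈ M, z ≠ y → RobustWalk G c i z y) (hμ : μ * Fintype.card V ≤ M.card) (hν0 : 0 ≤ ν)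
    (hν : ∀ z ∈ M, ν * Fintype.card V ≤ nbr G x Finset.univ - mis G z Finset.univ)
    (hc0 : 0 < c) (hc : c * Fintype.card V + 1 < μ * ν * Fintype.card V / 2) :
    RobustWalk G c (i + 2) x y := by
  classical
  set n : ℝ := (Fintype.card V : ℝ) with hn'
  have hn0 : 0 ≤ n := by positivity
  obtain ⟨N, -, hN, hNc⟩ := exists_nbr_eq_card (G := G) x Finset.univ
  simp only [Finset.mem_univ, true_and] at hN
  set F := N.filter fun p => c * n + 1 ≤ nbr G p M with hF
  refine robustWalk_succ_of_le_nbr F (fun p hp _ => ?_) ?_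
  · rw [hF, Finset.mem_filter] at hp
    exact robustWalk_succ_of_le_nbr M hM hp.2
  have h1 : ((c * n + 1 : ℝ) ≤ F.card) := by
    by_contra hcon
    rw [not_le] at hcon
    have e1 : ∀ z ∈ M, ν * n ≤ nbr G z N := by
      intro z hz
      have f1 := hν z hz
      have f2 := mis_mono (G := G) z (Finset.subset_univ N)
      rw [hNc] at f1
      unfold mis at f1 f2
      linarith
    have e2 := Finset.card_nsmul_le_sum M (fun z => nbr G z N) _ e1
    rw [nsmul_eq_mul, sum_nbr_comm] at e2
    have e3 := Finset.sum_sdiff (f := fun w => nbr G w M)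
      (show F ⊆ N from Finset.filter_subset _ _)
    have e4 : ∑ p ∈ N \ F, nbr G p M ≤ n * (c * n + 1) := by
      refine (Finset.sum_le_card_nsmul _ _ (c * n + 1) fun p hp => ?_).trans ?_
      · simp only [hF, Finset.mem_sdiff, Finset.mem_filter, not_and, not_le] at hp
        exact (hp.2 hp.1).le
      · rw [nsmul_eq_mul]
        have : ((N \ F).card : ℝ) ≤ n := by rw [hn']; exact_mod_cast Finset.card_le_univ _
        gcongr
    have e5 : ∑ p ∈ F, nbr G p M ≤ (c * n + 1) * n := by
      refine (Finset.sum_le_card_nsmul _ _ n fun p _ => (nbr_le_card p M).trans ?_).trans ?_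
      · rw [hn']; exact_mod_cast Finset.card_le_univ _
      · rw [nsmul_eq_mul]
        gcongr
    have e6 : (μ * n) * (ν * n) ≤ M.card * (ν * n) := by gcongr
    have e7 : (c * n + 1) * n ≤ (μ * ν * n / 2) * n := by gcongr
    rcases hn0.eq_or_lt with h | h
    · rw [← h] at hc hcon
      norm_num at hc
    · have e8 : (c * n + 1) * n < (μ * ν * n / 2) * n := by gcongr
      linarith
  exact h1.trans (card_le_nbr subset_rfl fun p hp =>
    (hN p).1 (Finset.mem_filter.1 hp).1)

set_option maxHeartbeats 1000000 in
theorem SplitPair.exists_exceptional {A B A₂ B₂ E : Finset V} (h : SplitPair G s t A B A₂ B₂ E)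
    (hs : 0 < s) (ht0 : 0 ≤ t) (hsn : 1 ≤ s * Fintype.card V) (hρ : 0 < ρ) (hρ1 : ρ ≤ 1)
    (hsρ : 28 * s ≤ ρ ^ 2)
    (hT : ∑ x, mis G x Finset.univ ≤ 2 * t * (Fintype.card V - t) + Fintype.card V) :
    t * (Fintype.card V - A₂.card - B₂.card) ≤ 14 * s * (Fintype.card V : ℝ) ^ 2 ∧
    (A.card - t) * (Fintype.card V - t - A₂.card) ≤ 14 * s * (Fintype.card V : ℝ) ^ 2 ∧
    (B.card - t) * (Fintype.card V - t - B₂.card) ≤ 14 * s * (Fintype.card V : ℝ) ^ 2 ∧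
    ∃ X : Finset V, (X.card : ℝ) ≤ ρ * Fintype.card V ∧ E ⊆ X ∧
      (∀ w ∉ X, w ∈ A → mis G w Finset.univ ≤ Fintype.card V - A₂.card + ρ * Fintype.card V) ∧
      (∀ w ∉ X, w ∈ B → mis G w Finset.univ ≤ Fintype.card V - B₂.card + ρ * Fintype.card V) ∧
      (∀ w ∉ X, w ∉ A → w ∉ B → mis G w Finset.univ ≤ t + ρ * Fintype.card V) := by
  classical
  set n : ℝ := (Fintype.card V : ℝ) with hn'
  have hn0 : 0 ≤ n := by positivity
  have hnpos : 0 < n := by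
    by_contra hcon
    have : n = 0 := le_antisymm (not_lt.1 hcon) hn0
    rw [this] at hsn; linarith
  have hA := h.le_cardA
  have hB := h.le_cardB
  have hI := h.card_inter
  have hA₂ := h.le_cardA₂
  have hB₂ := h.le_cardB₂
  have hI₂ := h.card_inter₂
  have hE := h.card_E
  rw [← hn'] at hI hA₂ hB₂ hI₂ hE
  have hAn : (A.card : ℝ) ≤ n := by rw [hn']; exact_mod_cast Finset.card_le_univ _
  have hBn : (B.card : ℝ) ≤ n := by rw [hn']; exact_mod_cast Finset.card_le_univ _
  have hV : ((A₂ ∪ B₂).card : ℝ) + (A₂ ∩ B₂).card = A₂.card + B₂.card := by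
    exact_mod_cast Finset.card_union_add_card_inter A₂ B₂
  have hV1 : ((A₂ ∪ B₂).card : ℝ) ≤ n := by rw [hn']; exact_mod_cast Finset.card_le_univ _
  set base : V → ℝ := fun w => if w ∈ A then n - A₂.card else if w ∈ B then n - B₂.card else t
    with hbase
  set F := E ∪ (A₂ ∩ B₂) ∪ (A ∩ B) with hF
  have hFc : (F.card : ℝ) ≤ 5 * s * n := by
    have e1 : (F.card : ℝ) ≤ E.card + (A₂ ∩ B₂).card + (A ∩ B).card := by
      exact_mod_cast (Finset.card_union_le _ _).trans
        (Nat.add_le_add_right (Finset.card_union_le _ _) _)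
    linarith
  have hbn : ∀ w, base w ≤ n := by
    intro w
    simp only [hbase]
    split_ifs
    · have : (0 : ℝ) ≤ A₂.card := Nat.cast_nonneg _
      linarith
    · have : (0 : ℝ) ≤ B₂.card := Nat.cast_nonneg _
      linarith
    · linarith
  have hlow : ∀ w ∈ Fᶜ, 0 ≤ mis G w Finset.univ - base w + s * n := by
    intro w hw
    simp only [hF, Finset.mem_compl, Finset.mem_union, Finset.mem_inter, not_or, not_and] at hw
    have eu : ((Finset.univ : Finset V).card : ℝ) = n := by rw [Finset.card_univ]
    simp only [hbase]
    split_ifs with h1 h2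
    · have e1 := h.nbr_A w h1 hw.1.1
      have e2 := nbr_univ_eq (G := G) w A₂
      have e3 := nbr_le_card (G := G) w A₂
      unfold mis
      linarith
    · have e1 := h.nbr_B w h2 hw.1.1
      have e2 := nbr_univ_eq (G := G) w B₂
      have e3 := nbr_le_card (G := G) w B₂
      unfold mis
      linarith
    · by_cases h3 : w ∈ A₂
      · have e1 := h.nbr_not_B₂ w (hw.1.2 h3)
        have e3 := mis_mono (G := G) w (Finset.subset_univ B)
        unfold mis at e3 ⊢
        linarith
      · have e1 := h.nbr_not_A₂ w h3
        have e3 := mis_mono (G := G) w (Finset.subset_univ A)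
        unfold mis at e3 ⊢
        linarith
  have hsumb : A.card * (n - A₂.card) + B.card * (n - B₂.card) + t * (n - A.card - B.card)
      - 2 * s * n ^ 2 ≤ ∑ w, base w := by
    have e1 : ∑ w ∈ A, base w = A.card * (n - A₂.card) := by
      rw [Finset.sum_congr rfl (g := fun _ => n - (A₂.card : ℝ)) fun w hw => by simp [hbase, hw],
        Finset.sum_const, nsmul_eq_mul]
    have e2 : ∑ w ∈ B \ A, base w = (B \ A).card * (n - B₂.card) := by
      rw [Finset.sum_congr rfl (g := fun _ => n - (B₂.card : ℝ)) fun w hw => by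
        rw [Finset.mem_sdiff] at hw; simp [hbase, hw], Finset.sum_const, nsmul_eq_mul]
    have e3 : ∑ w ∈ (A ∪ B)ᶜ, base w = ((A ∪ B)ᶜ).card * t := by
      rw [Finset.sum_congr rfl (g := fun _ => t) fun w hw => by
        rw [Finset.mem_compl, Finset.mem_union, not_or] at hw; simp [hbase, hw]]
      simp
    have e4 : ∑ w, base w = ∑ w ∈ A, base w + ∑ w ∈ B \ A, base w + ∑ w ∈ (A ∪ B)ᶜ, base w := by
      rw [← Finset.sum_union Finset.disjoint_sdiff, Finset.union_sdiff_self_eq_union,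
        Finset.sum_add_sum_compl]
    have e5 : ((B \ A).card : ℝ) = B.card - (A ∩ B).card := by
      have : (B \ A).card + (A ∩ B).card = B.card := by
        rw [Finset.inter_comm]; exact Finset.card_sdiff_add_card_inter B A
      rw [← this]; push_cast; ring
    have e6 := card_compl_eq (A ∪ B)
    have e7 : ((A ∪ B).card : ℝ) + (A ∩ B).card = A.card + B.card := by
      exact_mod_cast Finset.card_union_add_card_inter A B
    rw [e4, e1, e2, e3, e5, e6, ← hn', show ((A ∪ B).card : ℝ) = A.card + B.card - (A ∩ B).card by
      linarith]
    have e8 : ((A ∩ B).card : ℝ) * (n - B₂.card - t) ≤ (2 * s * n) * n := by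
      have f1 : ((A ∩ B).card : ℝ) * (n - B₂.card - t) ≤ (A ∩ B).card * n := by
        have : (0 : ℝ) ≤ B₂.card := Nat.cast_nonneg _
        gcongr
        linarith
      refine f1.trans ?_
      gcongr
    linarith
  have hsum : ∑ w ∈ Fᶜ, (mis G w Finset.univ - base w + s * n) ≤
      2 * t * (n - t) + n - ∑ w, base w + 6 * s * n ^ 2 := by
    rw [Finset.sum_add_distrib, Finset.sum_sub_distrib]
    have e1 : ∑ w ∈ Fᶜ, mis G w Finset.univ ≤ ∑ w, mis G w Finset.univ :=
      Finset.sum_le_sum_of_subset_of_nonneg (Finset.subset_univ _) fun w _ _ => mis_nonneg w _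
    have e2 := Finset.sum_add_sum_compl F base
    have e3 : ∑ w ∈ F, base w ≤ (5 * s * n) * n := by
      refine (Finset.sum_le_card_nsmul _ _ n fun w _ => hbn w).trans ?_
      rw [nsmul_eq_mul]
      gcongr
    have e4 : ∑ w ∈ Fᶜ, s * n ≤ n * (s * n) := by
      rw [Finset.sum_const, nsmul_eq_mul]
      have : ((Fᶜ).card : ℝ) ≤ n := by rw [hn']; exact_mod_cast Finset.card_le_univ _
      gcongr
    linarith
  have hsn2 : n ≤ s * n ^ 2 := by nlinarith
  have hslack : ∑ w ∈ Fᶜ, (mis G w Finset.univ - base w + s * n) + t * (n - A₂.card - B₂.card)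
      + (A.card - t) * (n - t - A₂.card) + (B.card - t) * (n - t - B₂.card) ≤ 9 * s * n ^ 2 := by
    linarith
  have hsl0 := Finset.sum_nonneg hlow
  have hp1 : - (s * n ^ 2) ≤ t * (n - A₂.card - B₂.card) := by
    have e1 : t * (-(s * n)) ≤ t * (n - A₂.card - B₂.card) := by gcongr; linarith
    have e2 : t * (s * n) ≤ n * (s * n) := by gcongr; linarith
    linarith
  have hp2 : - (2 * s * n ^ 2) ≤ (A.card - t) * (n - t - A₂.card) := by
    have e1 : (A.card - t) * (-(2 * s * n)) ≤ (A.card - t) * (n - t - A₂.card) :=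
      mul_le_mul_of_nonneg_left (by linarith) (by linarith)
    have e2 : (A.card - t) * (2 * s * n) ≤ n * (2 * s * n) := by gcongr; linarith
    linarith
  have hp3 : - (2 * s * n ^ 2) ≤ (B.card - t) * (n - t - B₂.card) := by
    have e1 : (B.card - t) * (-(2 * s * n)) ≤ (B.card - t) * (n - t - B₂.card) :=
      mul_le_mul_of_nonneg_left (by linarith) (by linarith)
    have e2 : (B.card - t) * (2 * s * n) ≤ n * (2 * s * n) := by gcongr; linarith
    linarith
  refine ⟨by linarith, by linarith, by linarith, ?_⟩
  have hmk := mul_card_filter_lt_le_sum hlow (ρ * n)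
  set Y := Fᶜ.filter fun w => ρ * n < mis G w Finset.univ - base w + s * n with hY
  have hYc : (Y.card : ℝ) ≤ ρ / 2 * n := by
    have e1 : (ρ * n) * Y.card ≤ (ρ * n) * (ρ / 2 * n) := by
      have : 28 * s * n ^ 2 ≤ ρ ^ 2 * n ^ 2 := by gcongr
      linarith
    exact le_of_mul_le_mul_left e1 (by positivity)
  have hsn' : s * n ≥ 0 := by positivity
  have key : ∀ w ∉ F ∪ Y, mis G w Finset.univ ≤ base w + ρ * n := by
    intro w hw
    rw [Finset.mem_union, not_or] at hw
    by_contra hcon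
    exact hw.2 (Finset.mem_filter.2 ⟨Finset.mem_compl.2 hw.1, by linarith⟩)
  refine ⟨F ∪ Y, ?_, ?_, ?_, ?_, ?_⟩
  · have e1 : ((F ∪ Y).card : ℝ) ≤ F.card + Y.card := by exact_mod_cast Finset.card_union_le _ _
    have e2 : 5 * s * n ≤ ρ / 2 * n := by gcongr; nlinarith
    linarith
  · intro w hw
    simp [hF, hw]
  · intro w hw hwA
    have := key w hw
    simpa [hbase, hwA] using this
  · intro w hw hwB
    have e1 := key w hw
    have e2 : w ∉ A := by
      intro hwA
      exact hw (by simp [hF, hwA, hwB])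
    simpa [hbase, hwB, e2] using e1
  · intro w hw hwA hwB
    have := key w hw
    simpa [hbase, hwA, hwB] using this

end Exceptional

section LinkedOrClique

variable {V : Type*} [Fintype V] [DecidableEq V] {G : SimpleGraph V} {c s t κ τ ρ θ δ : ℝ}
  {χ : Sym2 V → ℕ} {k : ℕ}

theorem SplitPair.exists_robustWalk_of_large {A B A₂ B₂ E : Finset V}
    (h : SplitPair G s t A B A₂ B₂ E)
    (hs : 0 < s) (ht0 : 0 ≤ t) (hsn : 1 ≤ s * Fintype.card V) (hρ : 0 < ρ) (hρ1 : ρ ≤ 1)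
    (hsρ : 28 * s ≤ ρ ^ 2) (hρκ : ρ ≤ κ / 10) (hc : 0 < c)
    (hcn : c * Fintype.card V + 1 < κ * (2 * ρ) * Fintype.card V / 2)
    (htκ : t ≤ (1 / 2 - κ) * Fintype.card V)
    (hT : ∑ x, mis G x Finset.univ ≤ 2 * t * (Fintype.card V - t) + Fintype.card V)
    (hA₂ : t + 4 * ρ * Fintype.card V ≤ A₂.card) (hB₂ : t + 4 * ρ * Fintype.card V ≤ B₂.card) :
    ∃ Y : Finset V, (Y.card : ℝ) ≤ ρ * Fintype.card V ∧
      ∀ x ∉ Y, ∀ y ∉ Y, RobustWalk G c 3 x y := by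
  classical
  obtain ⟨-, p2, p3, X, hX, -, hXA, hXB, hXR⟩ := h.exists_exceptional hs ht0 hsn hρ hρ1 hsρ hT
  set n : ℝ := (Fintype.card V : ℝ) with hn'
  have hnpos : 0 < n := by
    by_contra hcon
    have : n = 0 := le_antisymm (not_lt.1 hcon) (by positivity)
    rw [this] at hsn; linarith
  have hI₂ := h.card_inter₂
  rw [← hn'] at hI₂
  have hV : ((A₂ ∪ B₂).card : ℝ) + (A₂ ∩ B₂).card = A₂.card + B₂.card := by
    exact_mod_cast Finset.card_union_add_card_inter A₂ B₂
  have hV1 : ((A₂ ∪ B₂).card : ℝ) ≤ n := by rw [hn']; exact_mod_cast Finset.card_le_univ _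
  have hsρ' : s * n ≤ ρ * n := by gcongr; nlinarith
  have hρn : 0 < ρ * n := by positivity
  have hρκn : ρ * n ≤ κ / 10 * n := by gcongr
  have hsq : 28 * s * n ^ 2 ≤ ρ ^ 2 * n ^ 2 := by gcongr
  have bound : ∀ a a₂ : ℝ, 0 ≤ a → 3 * ρ * n ≤ a₂ → a * a₂ ≤ 14 * s * n ^ 2 → a ≤ ρ * n := by
    intro a a₂ ha ha₂ haa
    by_contra hcon
    rw [not_le] at hcon
    have : (ρ * n) * (3 * ρ * n) ≤ a * a₂ := by gcongr
    have : 0 < ρ ^ 2 * n ^ 2 := by positivity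
    linarith
  have hVc : ((A₂ ∪ B₂).card : ℝ) ≥ A₂.card + B₂.card - s * n := by linarith
  have hAc := bound _ _ (sub_nonneg.2 h.le_cardA) (by linarith) p2
  have hBc := bound _ _ (sub_nonneg.2 h.le_cardB) (by linarith) p3
  set H := (A ∪ B ∪ X)ᶜ with hH
  have hHc : κ * n ≤ H.card := by
    have e1 := card_compl_eq (A ∪ B ∪ X)
    have e2 : ((A ∪ B ∪ X).card : ℝ) ≤ A.card + B.card + X.card := by
      exact_mod_cast (Finset.card_union_le _ _).trans
        (Nat.add_le_add_right (Finset.card_union_le _ _) _)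
    rw [← hH] at e1
    linarith
  have hHm : ∀ w ∈ H, mis G w Finset.univ ≤ t + ρ * n := by
    intro w hw
    simp only [hH, Finset.mem_compl, Finset.mem_union, not_or] at hw
    exact hXR w hw.2 hw.1.1 hw.1.2
  have eu : ((Finset.univ : Finset V).card : ℝ) = n := by rw [Finset.card_univ]
  have hdeg : ∀ w ∉ X, t + 3 * ρ * n ≤ nbr G w Finset.univ := by
    intro w hw
    have key : mis G w Finset.univ ≤ n - (t + 3 * ρ * n) := by
      by_cases hA : w ∈ A
      · have := hXA w hw hA; linarith
      by_cases hB : w ∈ B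
      · have := hXB w hw hB; linarith
      have := hXR w hw hA hB
      linarith
    unfold mis at key
    linarith
  refine ⟨X, hX, fun x hx y hy => ?_⟩
  refine robustWalk_add_two_of_le (i := 1) (μ := κ) (ν := 2 * ρ) H (fun z hz _ => ?_) hHc
    (by positivity) (fun z hz => ?_) hc hcn
  · have e1 := hHm z hz
    have e2 := hdeg y hy
    have e3 : RobustWalk G c 1 y z := robustWalk_one_of_le Finset.univ (by
      rw [← hn']
      have e4 : κ * (2 * ρ) * n / 2 ≤ 2 * (ρ * n) := by
        have : κ ≤ 1 / 2 := by
          by_contra hcon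
          rw [not_le] at hcon
          have : (1 / 2 - κ) * n < 0 := mul_neg_of_neg_of_pos (by linarith) hnpos
          linarith
        have : κ * (ρ * n) ≤ 1 / 2 * (ρ * n) := by gcongr
        linarith
      linarith)
    obtain ⟨S, hS, hSc⟩ := robustWalk_succ_iff.1 e3
    exact robustWalk_succ_iff.2 ⟨S, fun w hw => ⟨(hS w hw).2.symm, (hS w hw).1.symm⟩, hSc⟩
  · have e1 := hHm z hz
    have e2 := hdeg x hx
    rw [← hn']
    linarith

set_option maxHeartbeats 2000000 in
theorem SplitPair.exists_robustWalk_or_sq_le {A B A₂ B₂ E : Finset V}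
    (h : SplitPair G s t A B A₂ B₂ E) (hχ : RainbowCycles G χ (2 * k + 1)) (hk : 4 ≤ k)
    (hn : (4 * k + 10 : ℝ) < 1 / 10 * Fintype.card V)
    (hs : 0 < s) (hτ : 0 < τ) (ht0 : τ * Fintype.card V ≤ t) (hsn : 1 ≤ s * Fintype.card V)
    (hρ : 0 < ρ) (hρ1 : ρ ≤ 1)
    (hsρ : 28 * s ≤ ρ ^ 2) (hsτ : 14 * s ≤ ρ * τ) (hsκ : 14 * s ≤ ρ * κ)
    (hρκ : ρ ≤ κ / 20) (hρθ : ρ ≤ θ / 20) (hθκ : θ ≤ κ) (hc : 0 < c)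
    (hcn : c * Fintype.card V + 1 < θ / 2 * κ * Fintype.card V / 2)
    (hδ : 0 < δ) (hδ' : δ ≤ 1 / 30) (hρδ : 7 * ρ + θ + 3 * s ≤ δ ^ 2)
    (htκ : t ≤ (1 / 2 - κ) * Fintype.card V)
    (hd : ∀ x, t ≤ nbr G x Finset.univ)
    (hT : ∑ x, mis G x Finset.univ ≤ 2 * t * (Fintype.card V - t) + Fintype.card V)
    (hB₂ : B₂.card < t + 4 * ρ * Fintype.card V) :
    (∃ Y : Finset V, (Y.card : ℝ) ≤ ρ * Fintype.card V ∧
      ∀ x ∉ Y, ∀ y ∉ Y, RobustWalk G c 3 x y) ∨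
    (Fintype.card V - t - ρ * Fintype.card V) ^ 2 - 3 * δ * (Fintype.card V : ℝ) ^ 2
      ≤ 2 * ((χ '' G.edgeSet).ncard : ℝ) := by
  classical
  have hn0 : (0 : ℝ) ≤ Fintype.card V := by positivity
  have ht0' : 0 ≤ t := le_trans (by positivity) ht0
  obtain ⟨p1, -, p3, X, hX, hEX, hXA, hXB, hXR⟩ :=
    h.exists_exceptional hs ht0' hsn hρ hρ1 hsρ hT
  set n : ℝ := (Fintype.card V : ℝ) with hn'
  have hk4 : (4 : ℝ) ≤ k := by exact_mod_cast hk
  have hnpos : 0 < n := by linarith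
  have hκ : 0 < κ := by linarith
  have hsρ' : s * n ≤ ρ * n := by gcongr; nlinarith
  have hρn : 0 < ρ * n := by positivity
  have hρκn : ρ * n ≤ κ / 20 * n := by gcongr
  have hρθn : ρ * n ≤ θ / 20 * n := by gcongr
  have hκ1 : κ ≤ 1 / 2 := by
    by_contra hcon
    rw [not_le] at hcon
    have : (1 / 2 - κ) * n < 0 := mul_neg_of_neg_of_pos (by linarith) hnpos
    linarith
  have eu : ((Finset.univ : Finset V).card : ℝ) = n := by rw [Finset.card_univ]
  have hA₂B₂ : n - A₂.card - B₂.card ≤ ρ * n := by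
    by_contra hcon
    rw [not_le] at hcon
    have e1 : (τ * n) * (ρ * n) < t * (n - A₂.card - B₂.card) := by
      apply mul_lt_mul' ht0 hcon hρn.le
      exact lt_of_lt_of_le (by positivity) ht0
    have e2 : 14 * s * n ^ 2 ≤ ρ * τ * n ^ 2 := by gcongr
    linarith
  have hBc : B.card - t ≤ ρ * n := by
    by_contra hcon
    rw [not_le] at hcon
    have e1 : (ρ * n) * (κ * n) < (B.card - t) * (n - t - B₂.card) := by
      apply mul_lt_mul hcon (by linarith) (by positivity) (by linarith)
    have e2 : 14 * s * n ^ 2 ≤ ρ * κ * n ^ 2 := by gcongr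
    linarith
  have hXo : ∀ w ∉ X, w ∉ B → mis G w Finset.univ ≤ t + 6 * ρ * n := by
    intro w hw hwB
    by_cases hA : w ∈ A
    · have := hXA w hw hA; linarith
    have := hXR w hw hA hwB
    linarith
  have hXi : ∀ w ∉ X, w ∈ B → nbr G w B₂ᶜ ≤ s * n := fun w hw hwB =>
    h.nbr_B w hwB fun hE => hw (hEX hE)
  have hBt := h.le_cardB
  have hB₂t := h.le_cardB₂
  rw [← hn'] at hB₂t
  by_cases hcase : θ * n ≤ (B₂ \ B).card
  · left
    refine ⟨X, hX, ?_⟩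
    set H := (B ∪ X)ᶜ with hH
    have hHc : n - t - 2 * (ρ * n) ≤ H.card := by
      have e1 := card_compl_eq (B ∪ X)
      have e2 : ((B ∪ X).card : ℝ) ≤ B.card + X.card := by
        exact_mod_cast Finset.card_union_le _ _
      rw [← hH] at e1
      linarith
    have hHm : ∀ w ∈ H, mis G w Finset.univ ≤ t + 6 * ρ * n := by
      intro w hw
      simp only [hH, Finset.mem_compl, Finset.mem_union, not_or] at hw
      exact hXo w hw.2 hw.1
    have hθn : 0 < θ * n := by linarith
    have hθκn : θ / 2 * κ * n / 2 ≤ κ / 2 * n ∧ θ / 2 * κ * n / 2 ≤ θ / 2 * n := by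
      have hθ1 : θ ≤ 1 := by linarith only [hθκ, hκ1]
      have hθ0 : 0 < θ := by linarith only [hρ, hρθ]
      have e1 : θ * (κ * n) ≤ 1 * (κ * n) := by gcongr
      have e2 : κ * (θ * n) ≤ 1 / 2 * (θ * n) := by gcongr
      have e3 : 0 < κ * n := by positivity
      constructor <;> linarith only [e1, e2, hθn, e3]
    have hHn : ∀ z ∉ X, θ / 2 * n ≤ nbr G z H := by
      intro z hz
      by_cases hzB : z ∈ B
      · have e1 := hXi z hz hzB
        have e2 := hd z
        rw [nbr_univ_eq z B₂] at e2
        have e3 := mis_mono (G := G) z (show B₂ \ B ⊆ B₂ from Finset.sdiff_subset)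
        have e4 := nbr_mono (G := G) z (show B₂ \ B ⊆ H ∪ X by
          intro w hw
          simp only [hH, Finset.mem_sdiff, Finset.mem_union, Finset.mem_compl] at hw ⊢
          tauto)
        have e5 := nbr_union_le (G := G) z H X
        have e6 := nbr_le_card (G := G) z X
        unfold mis at e3
        linarith
      · have e1 := hXo z hz hzB
        have e2 := mis_mono (G := G) z (Finset.subset_univ H)
        have : θ * n ≤ κ * n := by gcongr
        unfold mis at e2 e1
        linarith
    intro x hx y hy
    refine robustWalk_succ_of_le_nbr H (fun z hz _ => ?_) ?_
    · obtain ⟨M, hM, hM1, hM2⟩ := exists_nbr_eq_card (G := G) y H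
      refine robustWalk_add_two_of_le (i := 0) (μ := θ / 2) (ν := κ) M (fun w hw _ => ?_) ?_
        hκ.le (fun w hw => ?_) hc hcn
      · exact ((hM1 w).1 hw).2.symm
      · rw [← hM2]; exact hHn y hy
      · have e1 := hHm z hz
        have e2 := hHm w (hM hw)
        rw [← hn']
        unfold mis at e1 e2 ⊢
        linarith
    · have := hHn x hx
      rw [← hn']
      linarith [hθκn.2]
  · right
    rw [not_le] at hcase
    set P := Bᶜ with hP
    have hPc : (P.card : ℝ) = n - B.card := card_compl_eq B
    have hPn : (P.card : ℝ) ≤ n := by rw [hn']; exact_mod_cast Finset.card_le_univ _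
    have hBP : ∑ w ∈ B, nbr G w P ≤ (2 * s + θ + s) * n ^ 2 := by
      have e1 : ∀ w ∈ B \ E, nbr G w P ≤ s * n + θ * n := by
        intro w hw
        rw [Finset.mem_sdiff] at hw
        have f1 := h.nbr_B w hw.1 hw.2
        have f2 := nbr_mono (G := G) w (show P ⊆ B₂ᶜ ∪ (B₂ \ B) by
          intro z hz
          simp only [hP, Finset.mem_sdiff, Finset.mem_union, Finset.mem_compl] at hz ⊢
          tauto)
        have f3 := nbr_union_le (G := G) w B₂ᶜ (B₂ \ B)
        have f4 := nbr_le_card (G := G) w (B₂ \ B)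
        linarith
      have hB1 : ((B \ E).card : ℝ) ≤ n := by rw [hn']; exact_mod_cast Finset.card_le_univ _
      have hθ0 : 0 < θ := by linarith only [hρ, hρθ]
      have e2 : ∑ w ∈ B \ E, nbr G w P ≤ n * (s * n + θ * n) := by
        refine (Finset.sum_le_card_nsmul _ _ _ e1).trans ?_
        rw [nsmul_eq_mul]
        gcongr
      have e3 : ∑ w ∈ B ∩ E, nbr G w P ≤ (2 * s * n) * n := by
        refine (Finset.sum_le_card_nsmul _ _ n fun w _ => (nbr_le_card w P).trans hPn).trans ?_
        rw [nsmul_eq_mul]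
        have : ((B ∩ E).card : ℝ) ≤ E.card := by
          exact_mod_cast Finset.card_le_card Finset.inter_subset_right
        have := h.card_E
        gcongr
        linarith
      have e4 := Finset.sum_inter_add_sum_sdiff B E (fun w => nbr G w P)
      linarith
    have hPB : ∑ w ∈ P, mis G w B ≥ P.card * B.card - (2 * s + θ + s) * n ^ 2 := by
      rw [sum_nbr_comm] at hBP
      unfold mis
      rw [Finset.sum_sub_distrib, Finset.sum_const, nsmul_eq_mul]
      linarith
    have hPu : ∑ w ∈ P, mis G w Finset.univ ≤ P.card * (t + 6 * ρ * n) + (ρ * n) * n := by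
      have e1 : ∑ w ∈ P \ X, mis G w Finset.univ ≤ P.card * (t + 6 * ρ * n) := by
        refine (Finset.sum_le_card_nsmul _ _ (t + 6 * ρ * n) fun w hw => ?_).trans ?_
        · simp only [hP, Finset.mem_sdiff, Finset.mem_compl] at hw
          exact hXo w hw.2 hw.1
        · rw [nsmul_eq_mul]
          have : ((P \ X).card : ℝ) ≤ P.card := by
            exact_mod_cast Finset.card_le_card Finset.sdiff_subset
          gcongr
      have e2 : ∑ w ∈ P ∩ X, mis G w Finset.univ ≤ (ρ * n) * n := by
        refine (Finset.sum_le_card_nsmul _ _ n fun w _ => (mis_le_card w _).trans eu.le).trans ?_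
        rw [nsmul_eq_mul]
        have : ((P ∩ X).card : ℝ) ≤ X.card := by
          exact_mod_cast Finset.card_le_card Finset.inter_subset_right
        gcongr
        linarith
      have e4 := Finset.sum_inter_add_sum_sdiff P X (fun w => mis G w Finset.univ)
      linarith
    have hPP : ∑ w ∈ P, mis G w P ≤ δ ^ 2 * n ^ 2 := by
      have e1 : ∑ w ∈ P, mis G w Finset.univ = ∑ w ∈ P, mis G w B + ∑ w ∈ P, mis G w P := by
        rw [← Finset.sum_add_distrib]
        refine Finset.sum_congr rfl fun w _ => ?_
        have := nbr_univ_eq (G := G) w B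
        unfold mis
        rw [eu, hPc, this]
        ring
      have e2 : (P.card : ℝ) * (t + 6 * ρ * n - B.card) ≤ n * (6 * ρ * n) := by
        have : (P.card : ℝ) * (t + 6 * ρ * n - B.card) ≤ P.card * (6 * ρ * n) := by
          gcongr; linarith
        refine this.trans ?_
        gcongr
      have e3 : (7 * ρ + θ + 3 * s) * n ^ 2 ≤ δ ^ 2 * n ^ 2 := by gcongr
      linarith
    have h6 := sq_card_le_of_near_clique hχ hk hn hδ hδ' (P := P) (by linarith) hPP
    rw [← hn'] at h6
    have h7 : (n - t - ρ * n) ^ 2 ≤ (P.card : ℝ) ^ 2 := by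
      have : 0 ≤ n - t - ρ * n := by nlinarith
      gcongr
      linarith
    linarith

theorem exists_robustWalk_or_sq_le (hχ : RainbowCycles G χ (2 * k + 1)) (hk : 4 ≤ k)
    (hn : (4 * k + 10 : ℝ) < 1 / 10 * Fintype.card V)
    (hs : 0 < s) (hs' : s ≤ 1 / 10) (hτ : 0 < τ) (ht0 : τ * Fintype.card V ≤ t)
    (hsn : 1 ≤ s * Fintype.card V)
    (hρ : 0 < ρ) (hρ1 : ρ ≤ 1)
    (hsρ : 28 * s ≤ ρ ^ 2) (hsτ : 14 * s ≤ ρ * τ) (hsκ : 14 * s ≤ ρ * κ)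
    (hρκ : ρ ≤ κ / 20) (hρθ : ρ ≤ θ / 20) (hθκ : θ ≤ κ) (hc : 0 < c) (hcs : c ≤ s ^ 4 / 2)
    (hcn : c * Fintype.card V + 1 < κ * ρ * Fintype.card V)
    (hδ : 0 < δ) (hδ' : δ ≤ 1 / 30) (hρδ : 7 * ρ + θ + 3 * s ≤ δ ^ 2)
    (htκ : t ≤ (1 / 2 - κ) * Fintype.card V)
    (hd : ∀ x, t ≤ nbr G x Finset.univ)
    (hT : ∑ x, mis G x Finset.univ ≤ 2 * t * (Fintype.card V - t) + Fintype.card V) :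
    (∃ Y : Finset V, (Y.card : ℝ) ≤ ρ * Fintype.card V ∧
      ∀ x ∉ Y, ∀ y ∉ Y, RobustWalk G c 3 x y) ∨
    (Fintype.card V - t - ρ * Fintype.card V) ^ 2 - 3 * δ * (Fintype.card V : ℝ) ^ 2
      ≤ 2 * ((χ '' G.edgeSet).ncard : ℝ) := by
  have hn0 : (0 : ℝ) < Fintype.card V := by
    have hk4 : (4 : ℝ) ≤ k := by exact_mod_cast hk
    linarith
  have ht0' : 0 ≤ t := le_trans (by positivity) ht0
  have hκ : 0 < κ := by linarith
  have hcn' : c * Fintype.card V + 1 < θ / 2 * κ * Fintype.card V / 2 := by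
    have : κ * ρ * Fintype.card V ≤ κ * (θ / 20) * Fintype.card V := by gcongr
    have : 0 < κ * θ * Fintype.card V := by
      have : 0 < θ := by linarith
      positivity
    linarith
  by_cases h3 : ∀ x y, RobustWalk G c 3 x y
  · exact Or.inl ⟨∅, by simp; positivity, fun x _ y _ => h3 x y⟩
  push Not at h3
  obtain ⟨x, y, hxy⟩ := h3
  obtain ⟨A, B, A₂, B₂, E, h⟩ := exists_splitPair (s := s) (t := t) hs hs' hc hcs hd
    (by
      refine le_trans ?_ ht0
      gcongr
      nlinarith) hxy
  by_cases hB₂ : B₂.card < t + 4 * ρ * Fintype.card V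
  · exact h.exists_robustWalk_or_sq_le hχ hk hn hs hτ ht0 hsn hρ hρ1 hsρ hsτ hsκ hρκ hρθ hθκ hc hcn'
      hδ hδ' hρδ htκ hd hT hB₂
  by_cases hA₂ : A₂.card < t + 4 * ρ * Fintype.card V
  · exact h.symm.exists_robustWalk_or_sq_le hχ hk hn hs hτ ht0 hsn hρ hρ1 hsρ hsτ hsκ hρκ hρθ hθκ hc
      hcn' hδ hδ' hρδ htκ hd hT hA₂
  exact Or.inl (h.exists_robustWalk_of_large hs ht0' hsn hρ hρ1 hsρ (by linarith) hc
    (by linarith) htκ hT (not_lt.1 hA₂) (not_lt.1 hB₂))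

end LinkedOrClique

section Core

variable {V : Type*} [Fintype V] {G : SimpleGraph V} {c s t κ τ ρ η δ : ℝ}
  {χ : Sym2 V → ℕ} {k : ℕ}

theorem sq_sub_le_of_small (hχ : RainbowCycles G χ (2 * k + 1)) (hk : 4 ≤ k)
    (hn : (4 * k + 10 : ℝ) < 1 / 10 * Fintype.card V) (hτn : 1 ≤ τ * Fintype.card V)
    (hδ : 0 < δ) (hδ' : δ ≤ 1 / 30) (hτδ : 3 * τ ≤ δ ^ 2)
    (ht : -1 / 2 < t) (htτ : t ≤ τ * Fintype.card V)
    (hT : ∑ x, mis G x Finset.univ ≤ 2 * t * (Fintype.card V - t) + Fintype.card V) :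
    (Fintype.card V - t) ^ 2 - 4 * δ * (Fintype.card V : ℝ) ^ 2
      ≤ 2 * ((χ '' G.edgeSet).ncard : ℝ) := by
  set n : ℝ := (Fintype.card V : ℝ) with hn'
  have hk4 : (4 : ℝ) ≤ k := by exact_mod_cast hk
  have hnpos : 0 < n := by linarith
  have hτ : 0 < τ := by
    by_contra hcon
    have := mul_nonpos_of_nonpos_of_nonneg (not_lt.1 hcon) hnpos.le
    linarith
  have hτ1 : τ ≤ δ / 30 := by nlinarith
  have eu : ((Finset.univ : Finset V).card : ℝ) = n := by rw [Finset.card_univ]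
  have h1 : 2 * t * (n - t) ≤ 2 * (τ * n) * n := by
    have : t * n ≤ (τ * n) * n := by gcongr
    nlinarith [sq_nonneg t]
  have h2 : n ≤ τ * n * n := by nlinarith
  have h3 : 3 * τ * n ^ 2 ≤ δ ^ 2 * n ^ 2 := by gcongr
  have h4 := sq_card_le_of_near_clique hχ hk hn hδ hδ' (P := Finset.univ)
    (by rw [eu]; linarith) (by rw [← hn']; linarith)
  rw [eu, ← hn'] at h4
  have h5 : (n - t) ^ 2 ≤ (n + 1 / 2) ^ 2 := by
    have : τ * n ≤ 1 / 30 * n := by gcongr; nlinarith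
    have : 0 ≤ n - t := by linarith
    gcongr
    linarith
  have h6 : τ * n * n ≤ δ / 30 * n * n := by gcongr
  have h7 : (0 : ℝ) < δ * n ^ 2 := by positivity
  linarith

variable [DecidableEq V]

theorem sq_sub_le_of_middle (hχ : RainbowCycles G χ (2 * k + 1)) (hk : 4 ≤ k)
    (hn : (4 * k + 10 : ℝ) < c * Fintype.card V)
    (hs : 0 < s) (hs' : s ≤ 1 / 10) (hτ : 0 < τ) (ht0 : τ * Fintype.card V ≤ t)
    (hsn : 1 ≤ s * Fintype.card V)
    (hρ : 0 < ρ) (hρ1 : ρ ≤ 1)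
    (hsρ : 28 * s ≤ ρ ^ 2) (hsτ : 14 * s ≤ ρ * τ) (hsκ : 14 * s ≤ ρ * κ)
    (hρκ : ρ ≤ κ / 20) (hρτ : ρ ≤ τ / 2) (hκ1 : κ ≤ 1) (hc : 0 < c) (hcs : c ≤ s ^ 4 / 2)
    (hcκ : c ≤ κ ^ 3 / 20) (hcρ : 2 * c ≤ κ * ρ) (hcτ : 4 * c ≤ τ)
    (hδ : 0 < δ) (hδ' : δ ≤ 1 / 30) (hρδ : 7 * ρ + κ + 3 * s ≤ δ ^ 2)
    (htκ : t ≤ (1 / 2 - κ) * Fintype.card V)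
    (hd : ∀ x, t ≤ nbr G x Finset.univ)
    (hT : ∑ x, mis G x Finset.univ ≤ 2 * t * (Fintype.card V - t) + Fintype.card V) :
    (Fintype.card V - t) ^ 2 - (3 * δ + 2 * ρ + 3 * κ) * (Fintype.card V : ℝ) ^ 2
      ≤ 2 * ((χ '' G.edgeSet).ncard : ℝ) := by
  classical
  set n : ℝ := (Fintype.card V : ℝ) with hn'
  have hk4 : (4 : ℝ) ≤ k := by exact_mod_cast hk
  have hκ : 0 < κ := by linarith
  have hnpos : 0 < n := by
    by_contra hcon
    have := mul_nonpos_of_nonneg_of_nonpos hc.le (not_lt.1 hcon)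
    linarith
  have eu : ((Finset.univ : Finset V).card : ℝ) = n := by rw [Finset.card_univ]
  have hcn1 : 2 * c * n ≤ κ * ρ * n := by gcongr
  have hcn2 : 4 * c * n ≤ τ * n := by gcongr
  have hτ2 : c ≤ 1 / 10 := by
    have : κ * ρ ≤ 1 * (1 / 20) := by gcongr; linarith
    linarith
  have hn10 : (4 * k + 10 : ℝ) < 1 / 10 * n := by
    have : c * n ≤ 1 / 10 * n := by gcongr
    linarith
  have ht0' : 0 ≤ t := le_trans (by positivity) ht0
  have htn : t ≤ n / 2 := by
    have : 0 < κ * n := by positivity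
    linarith
  have hδn : 0 < δ * n ^ 2 := by positivity
  have hκn : 0 < κ * n ^ 2 := by positivity
  have hρn : 0 < ρ * n ^ 2 := by positivity
  rcases exists_robustWalk_or_sq_le hχ hk hn10 hs hs' hτ ht0 hsn hρ hρ1 hsρ hsτ hsκ hρκ hρκ le_rfl
    hc hcs (by rw [← hn']; linarith) hδ hδ' hρδ htκ hd hT with ⟨Y, hY, hY3⟩ | h
  · obtain ⟨C, hC, hCs⟩ := exists_conflict_set hκ hκ1 hκ le_rfl hc (by linarith) (by linarith)
      (by linarith) htκ hd hT
    rw [← hn'] at hY hC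
    set Q := Yᶜ with hQ
    have hρτn : ρ * n ≤ τ / 2 * n := by gcongr
    have hm := sum_nbr_le_ncard_colors (Q := Q) (C := C) hχ hk hn
      (fun x hx y hy _ => hY3 x (Finset.mem_compl.1 hx) y (Finset.mem_compl.1 hy))
      (fun x _ => by
        have e1 := hd x
        rw [nbr_univ_eq x Y, ← hQ] at e1
        have e2 := nbr_le_card (G := G) x Y
        rw [← hn']
        linarith)
      (fun x _ hx y _ hy hxy => hCs x hx y hy hxy)
    have e1 : ∑ x, mis G x Finset.univ = n * n - ∑ x, nbr G x Finset.univ := by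
      unfold mis
      rw [Finset.sum_sub_distrib, Finset.sum_const, nsmul_eq_mul, eu]
    have hYn : ∀ S : Finset V, ∑ x ∈ Y, nbr G x S ≤ (ρ * n) * n := by
      intro S
      refine (Finset.sum_le_card_nsmul _ _ n fun w _ => (nbr_le_card w S).trans ?_).trans ?_
      · rw [hn']; exact_mod_cast Finset.card_le_univ _
      · rw [nsmul_eq_mul]; gcongr
    have e2 : ∑ x, nbr G x Finset.univ = ∑ x ∈ Y, nbr G x Finset.univ + ∑ x ∈ Q, nbr G x Y
        + ∑ x ∈ Q, nbr G x Q := by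
      rw [add_assoc, ← Finset.sum_add_distrib, ← Finset.sum_add_sum_compl Y]
      congr 1
      exact Finset.sum_congr rfl fun x _ => nbr_univ_eq x Y
    have e3 : ∑ x ∈ Q, nbr G x Y ≤ (ρ * n) * n := by
      rw [sum_nbr_comm]; exact hYn Q
    have e4 := hYn Finset.univ
    have e5 : (C.card : ℝ) ^ 2 ≤ (t + κ * n) ^ 2 := by gcongr
    have e6 : κ * n * t ≤ κ * n * (n / 2) := by gcongr
    have e7 : κ * (κ * n ^ 2) ≤ 1 * (κ * n ^ 2) := by gcongr
    have e8 : n ≤ κ * n ^ 2 := by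
      have : 1 ≤ κ * n := by
        have : κ * ρ * n ≤ κ * 1 * n := by gcongr
        linarith
      nlinarith
    linarith
  · have e1 : (n - t) * (ρ * n) ≤ n * (ρ * n) := by gcongr; linarith
    have e2 : 0 ≤ (ρ * n) ^ 2 := sq_nonneg _
    rw [← hn'] at h
    linarith

end Core

theorem exists_forall_sq_sub_le {k : ℕ} (hk : 4 ≤ k) {ε : ℝ} (hε : 0 < ε) :
    ∃ N : ℕ, ∀ (V : Type) [Fintype V] (G : SimpleGraph V) (χ : Sym2 V → ℕ) (t : ℝ),
      N ≤ Fintype.card V → -1 / 2 < t → t ≤ Fintype.card V / 2 →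
      (∀ x, t ≤ nbr G x Finset.univ) →
      ∑ x, mis G x Finset.univ ≤ 2 * t * (Fintype.card V - t) + Fintype.card V →
      (Fintype.card V : ℝ) ^ 2 < 2 * ∑ x, nbr G x Finset.univ →
      RainbowCycles G χ (2 * k + 1) →
      (Fintype.card V - t) ^ 2 - ε * (Fintype.card V : ℝ) ^ 2
        ≤ 2 * ((χ '' G.edgeSet).ncard : ℝ) := by
  obtain ⟨δ, hδ, hδ1, hδε⟩ : ∃ δ : ℝ, 0 < δ ∧ δ ≤ 1 / 100 ∧ 10 * δ ≤ ε :=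
    ⟨min (1 / 100) (ε / 10), by positivity, min_le_left _ _, by
      have := min_le_right (1 / 100) (ε / 10); linarith⟩
  have hδ2 : δ ^ 2 ≤ 1 / 100 * δ := by nlinarith
  obtain ⟨κ, hκ⟩ : ∃ κ : ℝ, κ = δ ^ 2 / 13 := ⟨_, rfl⟩
  have hκ0 : 0 < κ := by rw [hκ]; positivity
  have hκ1 : κ ≤ 1 / 1000 := by linarith
  obtain ⟨s, hs⟩ : ∃ s : ℝ, s = (κ / 20) ^ 2 / 28 := ⟨_, rfl⟩
  have hs0 : 0 < s := by rw [hs]; positivity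
  have hκsq : κ ^ 2 ≤ 1 / 1000 * κ := by nlinarith
  have hs1 : s ≤ κ ^ 2 / 10000 := by
    have : 0 < κ ^ 2 := by positivity
    rw [hs]; linarith
  have hs2 : s ^ 2 ≤ 1 / 1000 * s := by nlinarith
  have hs4 : s ^ 4 ≤ 1 / 1000 * s := by nlinarith [sq_nonneg s]
  obtain ⟨c, hc⟩ : ∃ c : ℝ, c = s ^ 4 / 2 := ⟨_, rfl⟩
  have hc0 : 0 < c := by rw [hc]; positivity
  have hcs : c ≤ s / 2 := by linarith
  have hcκ8 : c ≤ (κ ^ 2) ^ 4 / 2 := by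
    rw [hc]
    have : s ≤ κ ^ 2 := by linarith [sq_nonneg κ]
    gcongr
  have hcκ3 : c ≤ κ ^ 3 / 20 := by
    have e1 : (κ ^ 2) ^ 4 ≤ κ ^ 3 * (1 / 1000) := by
      calc (κ ^ 2) ^ 4 = κ ^ 3 * κ ^ 4 * κ := by ring
        _ ≤ κ ^ 3 * 1 * (1 / 1000) := by
          have : κ ^ 4 ≤ 1 := pow_le_one₀ hκ0.le (by linarith)
          gcongr
        _ = _ := by ring
    have : 0 < κ ^ 3 := by positivity
    linarith
  have hk4 : (4 : ℝ) ≤ k := by exact_mod_cast hk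
  refine ⟨⌈(4 * k + 10) / c⌉₊ + 1, fun V _ G χ t hN ht0 ht2 hd hT he hχ => ?_⟩
  classical
  set n : ℝ := (Fintype.card V : ℝ) with hn'
  have hn : (4 * k + 10 : ℝ) < c * n := by
    have h1 : ((⌈(4 * k + 10) / c⌉₊ + 1 : ℕ) : ℝ) ≤ n := by rw [hn']; exact_mod_cast hN
    have h2 := Nat.le_ceil ((4 * k + 10 : ℝ) / c)
    push_cast at h1
    have h3 : (4 * k + 10 : ℝ) / c < n := by linarith
    rw [div_lt_iff₀ hc0] at h3
    linarith
  have hnpos : 0 < n := by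
    by_contra hcon
    have := mul_nonpos_of_nonneg_of_nonpos hc0.le (not_lt.1 hcon)
    linarith
  have hn2 : 0 < n ^ 2 := by positivity
  have hcn : c * n ≤ s / 2 * n := by gcongr
  have hsn : s * n ≤ κ * n := by gcongr; linarith
  have hκn : κ * n ≤ 1 / 1000 * n := by gcongr
  have hδn : 10 * δ * n ^ 2 ≤ ε * n ^ 2 := by gcongr
  have hκδn : κ * n ^ 2 ≤ δ / 1000 * n ^ 2 := by gcongr; linarith
  have hδn0 : 0 < δ * n ^ 2 := by positivity
  rcases le_total t (κ * n) with h1 | h1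
  · have := sq_sub_le_of_small hχ hk (τ := κ) (by linarith) (by rw [← hn']; linarith) hδ
      (by linarith) (by linarith) ht0 h1 hT
    rw [← hn'] at this
    linarith
  rcases le_total ((1 / 2 - κ) * n) t with h2 | h2
  · have := sq_le_of_near_half hχ hk hκ0 hκ1 hc0 hcκ8 hn hδ hδ1 (by linarith) hd h2 he
    rw [← hn'] at this
    have e1 : (n - t) ^ 2 ≤ ((1 / 2 + κ) * n) ^ 2 := by
      have : 0 ≤ n - t := by linarith
      gcongr
      linarith
    linarith
  · have := sq_sub_le_of_middle (ρ := κ / 20) (κ := κ) (τ := κ) hχ hk hn hs0 (by linarith) hκ0 h1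
      (by rw [← hn']; linarith) (by positivity) (by linarith) (by rw [hs]; linarith)
      (by linarith) (by linarith) le_rfl (by linarith) (by linarith) hc0 hc.le hcκ3
      (by linarith) (by linarith) hδ (by linarith) (by linarith) h2 hd hT
    rw [← hn'] at this
    linarith

section Reduction

variable {V : Type*} {G : SimpleGraph V} {χ : Sym2 V → ℕ} {L : ℕ}

theorem RainbowCycles.comap {W : Type*} (f : W ↪ V) (hχ : RainbowCycles G χ L) :
    RainbowCycles (G.comap f) (χ ∘ Sym2.map f) L := by
  intro v w hw hl
  have h := hχ (w.map (Hom.comap f G)) (hw.map f.injective) (by simpa using hl)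
  rw [Walk.edges_map, List.map_map] at h
  exact h

theorem image_edgeSet_comap_subset {W : Type*} (f : W → V) :
    (χ ∘ Sym2.map f) '' (G.comap f).edgeSet ⊆ χ '' G.edgeSet := by
  rintro _ ⟨e, he, rfl⟩
  refine ⟨Sym2.map f e, ?_, rfl⟩
  induction e with
  | _ x y => simpa using he

theorem nbr_comap_subtype [DecidableEq V] {W : Finset V} (x : {x // x ∈ W}) :
    nbr (G.comap (Function.Embedding.subtype fun x => x ∈ W)) x Finset.univ = nbr G x W := by
  classical
  rw [nbr_eq_card, nbr_eq_card, Nat.cast_inj]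
  refine Finset.card_bij (fun y _ => (y : V)) ?_ ?_ ?_
  · intro y hy
    simpa using hy
  · intro y _ z _ h
    exact Subtype.ext h
  · intro y hy
    rw [Finset.mem_filter] at hy
    exact ⟨⟨y, hy.1⟩, by simpa using hy.2, rfl⟩

theorem sum_nbr_univ [Fintype V] [DecidableEq V] :
    ∑ x, nbr G x Finset.univ = 2 * (G.edgeSet.ncard : ℝ) := by
  classical
  have h := G.sum_degrees_eq_twice_card_edges
  rw [← coe_edgeFinset, Set.ncard_coe_finset]
  have h2 : ∀ x, nbr G x Finset.univ = (G.degree x : ℝ) := by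
    intro x
    rw [nbr_eq_card, ← card_neighborFinset_eq_degree, neighborFinset_eq_filter]
  simp only [h2]
  exact_mod_cast h

theorem nbr_erase_self [DecidableEq V] (x : V) (S : Finset V) :
    nbr G x (S.erase x) = nbr G x S := by
  classical
  rw [nbr_eq_card, nbr_eq_card]
  congr 2
  ext y
  simp only [Finset.mem_filter, Finset.mem_erase]
  constructor
  · rintro ⟨⟨-, h1⟩, h2⟩; exact ⟨h1, h2⟩
  · rintro ⟨h1, h2⟩; exact ⟨⟨h2.ne', h1⟩, h2⟩

theorem sum_nbr_erase [DecidableEq V] {S : Finset V} {x : V} (hx : x ∈ S) :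
    ∑ y ∈ S, nbr G y S = ∑ y ∈ S.erase x, nbr G y (S.erase x) + 2 * nbr G x S := by
  have h1 := Finset.add_sum_erase S (fun y => nbr G y S) hx
  have h2 := sum_nbr_comm (G := G) (S.erase x) S
  have h3 := Finset.add_sum_erase S (fun y => nbr G y (S.erase x)) hx
  rw [nbr_erase_self] at h3
  linarith

theorem exists_dense_subset [Fintype V] [DecidableEq V] {m : ℝ}
    (hm : m ^ 2 + (Fintype.card V - m) ^ 2 ≤ ∑ x, nbr G x Finset.univ) :
    ∃ W : Finset V, m ^ 2 + (W.card - m) ^ 2 ≤ ∑ x ∈ W, nbr G x W ∧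
      ∀ x ∈ W, (W.card : ℝ) - m - 1 / 2 ≤ nbr G x W := by
  classical
  obtain ⟨W, hW, hmin⟩ := Finset.exists_min_image
    (Finset.univ.filter fun W : Finset V => m ^ 2 + (W.card - m) ^ 2 ≤ ∑ x ∈ W, nbr G x W)
    Finset.card ⟨Finset.univ, by simpa using hm⟩
  rw [Finset.mem_filter] at hW
  refine ⟨W, hW.2, fun x hx => ?_⟩
  by_contra hcon
  rw [not_le] at hcon
  have h1 := sum_nbr_erase (G := G) hx
  have h2 : ((W.erase x).card : ℝ) = W.card - 1 := by
    rw [Finset.card_erase_of_mem hx, Nat.cast_pred (Finset.card_pos.2 ⟨x, hx⟩)]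
  have h3 := hmin (W.erase x) (by
    rw [Finset.mem_filter]
    refine ⟨Finset.mem_univ _, ?_⟩
    rw [h2]
    linarith [hW.2])
  have h4 := Finset.card_erase_lt_of_mem hx
  omega

end Reduction

theorem exists_forall_le_ncard_colors {k : ℕ} (hk : 4 ≤ k) {ε : ℝ} (hε : 0 < ε) :
    ∃ N : ℕ, ∀ n : ℕ, N ≤ n → ∀ (G : SimpleGraph (Fin n)) (χ : Sym2 (Fin n) → ℕ) (x : ℝ),
      0 < x → (n : ℝ) ^ 2 / 4 + x ^ 2 ≤ G.edgeSet.ncard → RainbowCycles G χ (2 * k + 1) →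
      (n / 2 + x) ^ 2 - ε * (n : ℝ) ^ 2 ≤ 2 * ((χ '' G.edgeSet).ncard : ℝ) := by
  obtain ⟨N, hN⟩ := exists_forall_sq_sub_le hk hε
  refine ⟨2 * N + 1, fun n hn G χ x hx he hχ => ?_⟩
  have hn1 : (2 * N + 1 : ℝ) ≤ n := by exact_mod_cast hn
  have hN0 : (0 : ℝ) ≤ N := Nat.cast_nonneg N
  obtain ⟨m, hm⟩ : ∃ m : ℝ, m = n / 2 + x := ⟨_, rfl⟩
  rw [← hm]
  obtain ⟨W, hW, hdeg⟩ := exists_dense_subset (G := G) (m := m) (by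
    rw [sum_nbr_univ, Fintype.card_fin, hm]
    linarith)
  set w : ℝ := (W.card : ℝ) with hw
  have hwn : w ≤ n := by
    have := Finset.card_le_univ W
    rw [Fintype.card_fin] at this
    rw [hw]
    exact_mod_cast this
  have hw0 : 0 ≤ w := Nat.cast_nonneg _
  have hup : ∑ y ∈ W, nbr G y W ≤ w * (w - 1) := by
    refine (Finset.sum_le_card_nsmul _ _ (w - 1) fun y hy => ?_).trans_eq (by rw [nsmul_eq_mul])
    rw [← nbr_erase_self]
    refine (nbr_le_card _ _).trans_eq ?_
    rw [Finset.card_erase_of_mem hy, Nat.cast_pred (Finset.card_pos.2 ⟨y, hy⟩)]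
  have hmw : m < w := by
    by_contra hcon
    rw [not_lt] at hcon
    nlinarith
  have hmw2 : 1 / 2 ≤ w - m := by
    have : 0 < m := by linarith
    nlinarith
  set f := Function.Embedding.subtype fun y => y ∈ W with hf
  have hc : Fintype.card {y // y ∈ W} = W.card := Fintype.card_coe W
  have hsum : ∑ y : {y // y ∈ W}, nbr (G.comap f) y Finset.univ = ∑ y ∈ W, nbr G y W := by
    rw [← Finset.sum_coe_sort W]
    exact Finset.sum_congr rfl fun y _ => nbr_comap_subtype y
  have hmis : ∑ y : {y // y ∈ W}, mis (G.comap f) y Finset.univ = w * w - ∑ y ∈ W, nbr G y W := by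
    unfold mis
    rw [Finset.sum_sub_distrib, hsum, Finset.sum_const, Finset.card_univ, hc, nsmul_eq_mul]
  have h := hN {y // y ∈ W} (G.comap f) (χ ∘ Sym2.map f) (w - m - 1 / 2)
    (by
      rw [hc]
      have : (N : ℝ) ≤ W.card := by linarith
      exact_mod_cast this) (by linarith) (by rw [hc]; linarith)
    (fun y => by rw [nbr_comap_subtype]; exact hdeg y y.2)
    (by rw [hmis, hc]; linarith)
    (by
      rw [hsum, hc]
      have : 0 < (w - 2 * m) ^ 2 := sq_pos_of_neg (by linarith)
      linarith)
    (hχ.comap f)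
  rw [hc] at h
  have h2 : (((χ ∘ Sym2.map f) '' (G.comap f).edgeSet).ncard : ℝ) ≤ (χ '' G.edgeSet).ncard := by
    exact_mod_cast Set.ncard_le_ncard (image_edgeSet_comap_subset f) (Set.toFinite _)
  have h3 : ε * w ^ 2 ≤ ε * (n : ℝ) ^ 2 := by gcongr
  have h4 : 0 < m := by linarith
  linarith

/-- The disjoint union of two cliques, on the first `m` and the last `n - m` vertices. -/
def twoCliques (n m : ℕ) : SimpleGraph (Fin n) where
  Adj i j := i ≠ j ∧ ((i : ℕ) < m ↔ (j : ℕ) < m)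
  symm := ⟨fun _ _ h => ⟨h.1.symm, h.2.symm⟩⟩
  loopless := ⟨fun _ h => h.1 rfl⟩

theorem twoCliques_iff_of_mem_support {n m : ℕ} {u v : Fin n} (w : (twoCliques n m).Walk u v)
    {a : Fin n} (ha : a ∈ w.support) : (a : ℕ) < m ↔ (u : ℕ) < m := by
  induction w with
  | nil => simp at ha; rw [ha]
  | cons h p ih =>
    rw [Walk.support_cons, List.mem_cons] at ha
    rcases ha with rfl | ha
    · rfl
    · exact (ih ha).trans h.2.symm

theorem le_two_mul_ncard_edgeSet_twoCliques {n m : ℕ} (hm : m ≤ n) :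
    (m : ℝ) ^ 2 + (n - m) ^ 2 - n ≤ 2 * ((twoCliques n m).edgeSet.ncard : ℝ) := by
  classical
  rw [← sum_nbr_univ]
  set S := Finset.univ.filter fun i : Fin n => (i : ℕ) < m with hS
  have hSc : (S.card : ℝ) = m := by
    rw [hS, Fin.card_filter_val_lt, min_eq_right hm]
  have hSc' : (Sᶜ.card : ℝ) = n - m := by
    rw [card_compl_eq, hSc, Fintype.card_fin]
  have h1 : ∀ T : Finset (Fin n), (∀ i ∈ T, ∀ j ∈ T, ((i : ℕ) < m ↔ (j : ℕ) < m)) →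
      (T.card : ℝ) * (T.card - 1) ≤ ∑ i ∈ T, nbr (twoCliques n m) i Finset.univ := by
    intro T hT
    rw [← nsmul_eq_mul]
    refine Finset.card_nsmul_le_sum _ _ _ fun i hi => ?_
    have h2 := card_le_nbr (G := twoCliques n m) (x := i) (Finset.subset_univ (T.erase i))
      fun j hj => ⟨(Finset.ne_of_mem_erase hj).symm, hT i hi j (Finset.mem_of_mem_erase hj)⟩
    rwa [Finset.card_erase_of_mem hi, Nat.cast_pred (Finset.card_pos.2 ⟨i, hi⟩)] at h2
  have h2 := h1 S fun i hi j hj => by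
    simp only [hS, Finset.mem_filter, Finset.mem_univ, true_and] at hi hj
    simp [hi, hj]
  have h3 := h1 Sᶜ fun i hi j hj => by
    simp only [hS, Finset.mem_compl, Finset.mem_filter, Finset.mem_univ, true_and] at hi hj
    simp [hi, hj]
  rw [← Finset.sum_add_sum_compl S]
  rw [hSc] at h2
  rw [hSc'] at h3
  linarith

theorem exists_rainbowCycles_twoCliques {n m : ℕ} (hm : n ≤ 2 * m) (L : ℕ) :
    ∃ χ : Sym2 (Fin n) → ℕ, RainbowCycles (twoCliques n m) χ L ∧
      (χ '' (twoCliques n m).edgeSet).ncard ≤ (m + 1).choose 2 := by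
  classical
  obtain ⟨g, hg⟩ := exists_injective_nat (Sym2 ℕ)
  set f : Fin n → ℕ := fun i => if (i : ℕ) < m then i else i - m with hf
  have hinj : ∀ a b : Fin n, ((a : ℕ) < m ↔ (b : ℕ) < m) → f a = f b → a = b := by
    intro a b hab h
    simp only [hf] at h
    ext
    split_ifs at h <;> omega
  refine ⟨fun e => g (e.map f), fun v w hw _ => ?_, ?_⟩
  · refine List.Nodup.map_on ?_ hw.isTrail.edges_nodup
    intro e he e' he' h
    have h1 := hg h
    induction e with
    | _ a b =>
    induction e' with
    | _ c d =>
    have ha := twoCliques_iff_of_mem_support w (w.fst_mem_support_of_mem_edges he)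
    have hb := twoCliques_iff_of_mem_support w (w.snd_mem_support_of_mem_edges he)
    have hc := twoCliques_iff_of_mem_support w (w.fst_mem_support_of_mem_edges he')
    have hd := twoCliques_iff_of_mem_support w (w.snd_mem_support_of_mem_edges he')
    simp only [Sym2.map_mk, Sym2.eq_iff] at h1 ⊢
    rcases h1 with h1 | h1
    · exact Or.inl ⟨hinj _ _ (ha.trans hc.symm) h1.1, hinj _ _ (hb.trans hd.symm) h1.2⟩
    · exact Or.inr ⟨hinj _ _ (ha.trans hd.symm) h1.1, hinj _ _ (hb.trans hc.symm) h1.2⟩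
  · have h1 : (fun e => g (Sym2.map f e)) '' (twoCliques n m).edgeSet ⊆
        (((Finset.range m).sym2.image g : Finset ℕ) : Set ℕ) := by
      rintro _ ⟨e, -, rfl⟩
      simp only [Finset.coe_image]
      refine ⟨_, ?_, rfl⟩
      rw [Finset.mem_coe, Finset.mem_sym2_iff]
      intro a ha
      rw [Sym2.mem_map] at ha
      obtain ⟨i, -, rfl⟩ := ha
      rw [Finset.mem_range]
      simp only [hf]
      have := i.2
      split_ifs <;> omega
    refine (Set.ncard_le_ncard h1 (Finset.finite_toSet _)).trans ?_
    rw [Set.ncard_coe_finset]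
    refine Finset.card_image_le.trans ?_
    rw [Finset.card_sym2, Finset.card_range]

theorem exists_rainbowCycles_two_mul_ncard_le {n e : ℕ} (L : ℕ) {x : ℝ} (hx : 0 ≤ x)
    (he : e ≤ n * (n - 1) / 2) (hex : (e : ℝ) = (n : ℝ) ^ 2 / 4 + x ^ 2) :
    ∃ G : SimpleGraph (Fin n), e ≤ G.edgeSet.ncard ∧ ∃ χ : Sym2 (Fin n) → ℕ,
      RainbowCycles G χ L ∧
        2 * ((χ '' G.edgeSet).ncard : ℝ) ≤ (n / 2 + x + √n + 2) ^ 2 := by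
  have hn0 : (0 : ℝ) ≤ n := Nat.cast_nonneg n
  have hsq := Real.sqrt_nonneg (n : ℝ)
  have hsq2 := Real.sq_sqrt hn0
  set m := min n ⌈(n : ℝ) / 2 + x + √n⌉₊ with hm
  have hmn : m ≤ n := min_le_left _ _
  have hm1 : (m : ℝ) ≤ n / 2 + x + √n + 1 := by
    have h1 : (m : ℝ) ≤ ⌈(n : ℝ) / 2 + x + √n⌉₊ := by exact_mod_cast min_le_right _ _
    have h2 := Nat.ceil_lt_add_one (show 0 ≤ (n : ℝ) / 2 + x + √n by positivity)
    linarith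
  have hm2 : m = n ∨ (n : ℝ) / 2 + x + √n ≤ m := by
    rcases le_total n ⌈(n : ℝ) / 2 + x + √n⌉₊ with h | h
    · exact Or.inl (min_eq_left h)
    · right
      rw [hm, min_eq_right h]
      exact Nat.le_ceil _
  have h2m : n ≤ 2 * m := by
    rcases hm2 with h | h
    · omega
    · have : (n : ℝ) ≤ 2 * m := by linarith
      exact_mod_cast this
  have hedge : e ≤ (twoCliques n m).edgeSet.ncard := by
    have h1 := le_two_mul_ncard_edgeSet_twoCliques hmn
    have h2 : (2 * e : ℝ) ≤ (m : ℝ) ^ 2 + (n - m) ^ 2 - n := by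
      rcases hm2 with h | h
      · have h3 : 2 * e ≤ n * (n - 1) := by omega
        have h4 : (2 * e : ℝ) ≤ n * (n - 1) := by
          rcases Nat.eq_zero_or_pos n with h0 | h0
          · subst h0
            have : e = 0 := by simpa using h3
            simp [this]
          · have : ((2 * e : ℕ) : ℝ) ≤ ((n * (n - 1) : ℕ) : ℝ) := by exact_mod_cast h3
            rw [Nat.cast_mul, Nat.cast_mul, Nat.cast_pred h0] at this
            exact_mod_cast this
        rw [h]
        linarith
      · have h3 : (x + √n) ^ 2 ≤ (m - n / 2 : ℝ) ^ 2 := by gcongr; linarith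
        have h4 : 0 ≤ x * √n := by positivity
        linarith
    have h5 : (e : ℝ) ≤ (twoCliques n m).edgeSet.ncard := by linarith
    exact_mod_cast h5
  obtain ⟨χ, hχ, hcol⟩ := exists_rainbowCycles_twoCliques h2m L
  refine ⟨_, hedge, χ, hχ, ?_⟩
  have h2 : (((χ '' (twoCliques n m).edgeSet).ncard : ℕ) : ℝ) ≤ ((m + 1).choose 2 : ℕ) := by
    exact_mod_cast hcol
  rw [Nat.cast_choose_two] at h2
  push_cast at h2
  have h3 : ((m : ℝ) + 1) ^ 2 ≤ (n / 2 + x + √n + 2) ^ 2 :=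
    pow_le_pow_left₀ (by positivity) (by linarith) 2
  have h4 : (0 : ℝ) ≤ m := Nat.cast_nonneg m
  linarith

/-- For every `k ≥ 4` and `ε > 0`, for all sufficiently large `n` and all
`⌊n²/4⌋ + 1 ≤ e ≤ n(n-1)/2`, we have
`|f(n, e, C_{2k+1}) - (e/2 + (n/2)·√(e - n²/4))| ≤ ε n²`. -/
theorem statement0 (k : ℕ) (hk : 4 ≤ k) (ε : ℝ) (hε : 0 < ε) :
    ∃ N : ℕ, ∀ n : ℕ, N ≤ n → ∀ e : ℕ, n ^ 2 / 4 + 1 ≤ e → e ≤ n * (n - 1) / 2 →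
      |(maxAntiRamseyCycle n e (2 * k + 1) : ℝ) -
          ((e : ℝ) / 2 + (n : ℝ) / 2 * Real.sqrt ((e : ℝ) - (n : ℝ) ^ 2 / 4))| ≤ ε * n ^ 2 := by
  obtain ⟨N, hN⟩ := exists_forall_le_ncard_colors hk hε
  refine ⟨max N (⌈(8 / ε) ^ 2⌉₊ + 1), fun n hn e he1 he2 => ?_⟩
  have hnN : N ≤ n := (le_max_left _ _).trans hn
  have hn8 : (8 / ε) ^ 2 ≤ n ∧ (1 : ℝ) ≤ n := by
    have h1 : ⌈(8 / ε) ^ 2⌉₊ + 1 ≤ n := (le_max_right _ _).trans hn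
    have h2 : ((⌈(8 / ε) ^ 2⌉₊ + 1 : ℕ) : ℝ) ≤ n := by exact_mod_cast h1
    push_cast at h2
    have h3 := Nat.le_ceil ((8 / ε) ^ 2)
    have h4 : (0 : ℝ) ≤ ⌈(8 / ε) ^ 2⌉₊ := Nat.cast_nonneg _
    constructor <;> linarith
  have hpos : 0 < (e : ℝ) - (n : ℝ) ^ 2 / 4 := by
    have h1 : n ^ 2 < 4 * e := by omega
    have h2 : ((n ^ 2 : ℕ) : ℝ) < ((4 * e : ℕ) : ℝ) := by exact_mod_cast h1
    push_cast at h2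
    linarith
  have heup : (e : ℝ) ≤ (n : ℝ) ^ 2 / 2 := by
    have h1 : 2 * e ≤ n * n := by
      have : n * (n - 1) ≤ n * n := Nat.mul_le_mul_left _ (Nat.sub_le _ _)
      omega
    have h2 : ((2 * e : ℕ) : ℝ) ≤ ((n * n : ℕ) : ℝ) := by exact_mod_cast h1
    push_cast at h2
    linarith
  set x := √((e : ℝ) - (n : ℝ) ^ 2 / 4) with hx
  have hx0 : 0 < x := Real.sqrt_pos.2 hpos
  have hx2 : x ^ 2 = (e : ℝ) - (n : ℝ) ^ 2 / 4 := Real.sq_sqrt hpos.le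
  have hxn : x ≤ n / 2 := by
    refine le_of_sq_le_sq ?_ (by positivity)
    linarith
  obtain ⟨G₀, hG₀, χ₀, hχ₀, hcol₀⟩ := exists_rainbowCycles_two_mul_ncard_le (n := n) (e := e)
    (2 * k + 1) hx0.le he2 (by linarith)
  rw [abs_le]
  constructor
  · have hne : {c : ℕ | ∃ G : SimpleGraph (Fin n), e ≤ G.edgeSet.ncard ∧
        ∃ χ : Sym2 (Fin n) → ℕ, (χ '' G.edgeSet).ncard ≤ c ∧
          ∀ ⦃v : Fin n⦄ (w : G.Walk v v), w.IsCycle → w.length = 2 * k + 1 →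
            (w.edges.map χ).Nodup}.Nonempty := ⟨_, G₀, hG₀, χ₀, le_rfl, hχ₀⟩
    obtain ⟨G, hG, χ, hcol, hχ⟩ := Nat.sInf_mem hne
    have h1 := hN n hnN G χ x hx0 (by
      have : (e : ℝ) ≤ G.edgeSet.ncard := by exact_mod_cast hG
      linarith) hχ
    have h2 : ((χ '' G.edgeSet).ncard : ℝ) ≤ maxAntiRamseyCycle n e (2 * k + 1) := by
      exact_mod_cast hcol
    have h3 : 0 < ε * (n : ℝ) ^ 2 := by
      have : (0 : ℝ) < n := by linarith
      positivity
    linarith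
  · have h0 : maxAntiRamseyCycle n e (2 * k + 1) ≤ (χ₀ '' G₀.edgeSet).ncard :=
      Nat.sInf_le ⟨G₀, hG₀, χ₀, le_rfl, hχ₀⟩
    have h1 : (maxAntiRamseyCycle n e (2 * k + 1) : ℝ) ≤ (χ₀ '' G₀.edgeSet).ncard := by
      exact_mod_cast h0
    have hs1 : 1 ≤ √(n : ℝ) := Real.one_le_sqrt.2 hn8.2
    have hs2 : 8 / ε ≤ √(n : ℝ) := Real.le_sqrt_of_sq_le hn8.1
    have hsq2 : √(n : ℝ) ^ 2 = n := Real.sq_sqrt (by linarith)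
    rw [div_le_iff₀ hε] at hs2
    have h2 : (n / 2 + x + √n + 2) ^ 2 ≤ (n / 2 + x + 3 * √n) ^ 2 :=
      pow_le_pow_left₀ (by positivity) (by linarith) 2
    have h3 : x * √n ≤ n / 2 * √n := by gcongr
    have h4 : (n : ℝ) * √n * 8 ≤ (n : ℝ) * √n * (√n * ε) := by gcongr
    have h5 : (n : ℝ) * √n * (√n * ε) = ε * n ^ 2 := by
      rw [show (n : ℝ) * √n * (√n * ε) = n * (√n ^ 2) * ε by ring, hsq2]; ring
    have h6 : (n : ℝ) * 1 ≤ n * √n := by gcongr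
    linarith
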